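/- Let G₁ and G₂ be nontrivial finitely generated groups with finite generating sets S₁ and S₂, and suppose for i = 1,2 there are groups Hᵢʲ (j = 1,2,…) and surjective homomorphisms φᵢʲ : Gᵢ → Hᵢʲ such that φᵢʲ is injective on the ball of radius j of the Cayley graph of (Gᵢ,Sᵢ) (the set of products of at most j elements of Sᵢ ∪ Sᵢ⁻¹). Then there exist constants c > 0 and γ > 0 such that for all j ≥ 1: 0 ≤ p_c(H₁ʲ*H₂ʲ) − p_c(G₁*G₂) ≤ c·e^{−γ j}, where p_c(H₁ʲ*H₂ʲ) is the critical probability of the Cayley graph of H₁ʲ*H₂ʲ with respect to φ₁ʲ(S₁) ⊔ φ₂ʲ(S₂) and p_c(G₁*G₂) is that of the Cayley graph of G₁*G₂ with respect to S₁ ⊔ S₂; in particular p_c(H₁ʲ*H₂ʲ) → p_c(G₁*G₂) as j → ∞. -/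

import Mathlib

open MeasureTheory ENNReal

namespace Perc

/-- Percolation configurations on the edge set `E`: each edge is `true` (open) or
`false` (closed). -/
abbrev Config (E : Type*) := E → Bool

/-- `μ` is the Bernoulli product measure `P_p` with parameter `p` on `{0,1}^E`: the measure
of every finite cylinder event is the corresponding product.  (This determines `μ` uniquely
on the product σ-algebra, since cylinders form a π-system generating it.) -/
def IsBernoulli {E : Type*} (p : ℝ) (μ : Measure (Config E)) : Prop :=
  ∀ (F : Finset E) (σ : E → Bool),
    μ {ω | ∀ e ∈ F, ω e = σ e} =
      ∏ e ∈ F, ENNReal.ofReal (if σ e then p else 1 - p)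

variable {G ι : Type*} [Group G]

/-- In the Cayley graph of `G` with edge set `G × ι`, where the edge `(a, i)` joins `a` and
`a * f i` (the function `f : ι → G` lists the generators, with multiplicity), this says that
vertices `a` and `b` are joined by some open edge of the configuration `ω`. -/
def Step (f : ι → G) (ω : Config (G × ι)) (a b : G) : Prop :=
  ∃ i : ι, (ω (a, i) = true ∧ b = a * f i) ∨ (ω (b, i) = true ∧ a = b * f i)

/-- `x` and `y` are connected by a path of open edges (`x ↔ y`). -/
def Conn (f : ι → G) (ω : Config (G × ι)) (x y : G) : Prop :=
  Relation.ReflTransGen (Step f ω) x y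

/-- The open cluster `C` of the identity. -/
def cluster (f : ι → G) (ω : Config (G × ι)) : Set G :=
  {x | Conn f ω 1 x}

/-- The percolation function `θ`: the probability that the cluster of the identity is
infinite. -/
noncomputable def theta (f : ι → G) (μ : Measure (Config (G × ι))) : ℝ :=
  (μ {ω | (cluster f ω).Infinite}).toReal

/-- The expected cluster size `χ = E(|C|) ∈ [0,∞]` (where `|C| ∈ ℕ∞` is coerced
to `ℝ≥0∞`). -/
noncomputable def chi (f : ι → G) (μ : Measure (Config (G × ι))) : ℝ≥0∞ :=
  ∫⁻ ω, ((cluster f ω).encard : ℝ≥0∞) ∂μ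

/-- The critical probability `p_c = inf {p ∈ [0,1] | θ(p) > 0}`, with the convention
`p_c = 1` if `θ` vanishes on `[0,1]`; here `μ p` is the percolation measure at
parameter `p`. -/
noncomputable def pc (f : ι → G) (μ : ℝ → Measure (Config (G × ι))) : ℝ :=
  sInf ({p | p ∈ Set.Icc (0 : ℝ) 1 ∧ 0 < theta f (μ p)} ∪ {1})

/-- The word metric on `G` with respect to the generators `f i`: the length of a shortest
word in the generators and their inverses taking `x` to `y`.  (When the generators generate
`G`, this is the graph distance in the Cayley graph.) -/
noncomputable def wdist (f : ι → G) (x y : G) : ℕ :=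
  sInf {n : ℕ | ∃ l : List G, l.length = n ∧
    (∀ g ∈ l, (∃ i, f i = g) ∨ (∃ i, (f i)⁻¹ = g)) ∧ x * l.prod = y}

/-- Schonmann's critical point
`p_exp = sup {p ∈ [0,1] | ∃ c > 0, γ > 0, ∀ x y, P_p(x ↔ y) ≤ c·exp(-γ·dist(x,y))}`. -/
noncomputable def pexp (f : ι → G) (μ : ℝ → Measure (Config (G × ι))) : ℝ :=
  sSup {p | p ∈ Set.Icc (0 : ℝ) 1 ∧ ∃ c > 0, ∃ γ > 0, ∀ x y : G,
    (μ p {ω | Conn f ω x y}).toReal ≤ c * Real.exp (-γ * (wdist f x y : ℝ))}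

/-- The walk-through function `g(p,t) = 1 - ∑_{n≥1} (1-t)^{n-1} P_p(|C| = n)` of a Cayley
graph; here `μ` is the percolation measure at parameter `p`. -/
noncomputable def wt (f : ι → G) (μ : Measure (Config (G × ι))) (t : ℝ) : ℝ :=
  1 - ∑' n : ℕ, (1 - t) ^ n * (μ {ω | (cluster f ω).encard = ((n + 1 : ℕ) : ℕ∞)}).toReal

/-- The ball of radius `j`: all products of at most `j` elements of `S ∪ S⁻¹`. -/
def ball (S : Set G) (j : ℕ) : Set G :=
  {g | ∃ l : List G, l.length ≤ j ∧ (∀ x ∈ l, x ∈ S ∨ x⁻¹ ∈ S) ∧ l.prod = g}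

/-- The Cheeger constant `h = inf_K |∂K| / |K|`, the infimum over nonempty finite vertex
sets `K` of the number of edges `(a, i)` (joining `a` and `a * f i`) with exactly one
endpoint in `K`, divided by `|K|`. -/
noncomputable def cheeger (f : ι → G) : ℝ :=
  ⨅ K : {K : Finset G // K.Nonempty},
    (Nat.card {e : G × ι // Xor' (e.1 ∈ K.1) (e.1 * f e.2 ∈ K.1)} : ℝ) / (K.1.card : ℝ)

/-- The open cluster of the identity in the subgraph induced on the vertex set `V`: only
open edges with both endpoints in `V` may be used. -/
def clusterIn (f : ι → G) (V : Set G) (ω : Config (G × ι)) : Set G :=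
  {x | Relation.ReflTransGen (fun a b => Step f ω a b ∧ a ∈ V ∧ b ∈ V) 1 x}

/-- The generators of `G` given by a generating set `S` (one edge orbit per element
of `S`). -/
def setGens (S : Set G) : S → G := Subtype.val

/-- The generators of the free product `G₁ * G₂` given by the disjoint union `S₁ ⊔ S₂` of
generating sets, embedded via the canonical monomorphisms. -/
def coprodGens {G₁ G₂ : Type*} [Group G₁] [Group G₂] (S₁ : Set G₁) (S₂ : Set G₂) :
    S₁ ⊕ S₂ → Monoid.Coprod G₁ G₂ :=
  Sum.elim (fun s => Monoid.Coprod.inl (s : G₁)) (fun s => Monoid.Coprod.inr (s : G₂))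

/-- The generators of the free product `G₁ * ⋯ * G_n` given by the disjoint union
`S₁ ⊔ ⋯ ⊔ S_n` of generating sets, embedded via the canonical monomorphisms. -/
def coprodIGens {n : ℕ} {G : Fin n → Type*} [∀ i, Group (G i)] (S : ∀ i, Set (G i)) :
    (Σ i, S i) → Monoid.CoprodI G :=
  fun x => Monoid.CoprodI.of (x.2 : G x.1)

/-- The image of a list of syllables in the free product `G₁ * G₂`. -/
def sylProd {G₁ G₂ : Type*} [Group G₁] [Group G₂] (l : List (G₁ ⊕ G₂)) :
    Monoid.Coprod G₁ G₂ :=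
  (l.map (Sum.elim (fun g => Monoid.Coprod.inl g) (fun h => Monoid.Coprod.inr h))).prod

/-- The set `P₁` of nontrivial elements of `G₁ * G₂` whose normal form begins with a
nontrivial syllable of `G₁`: elements represented by a nonempty alternating product of
nontrivial syllables, the first syllable lying in `G₁`.  (Such a representation is the
normal form, which is unique.) -/
def beginsLeft {G₁ G₂ : Type*} [Group G₁] [Group G₂] (x : Monoid.Coprod G₁ G₂) : Prop :=
  ∃ l : List (G₁ ⊕ G₂), l ≠ [] ∧ (∀ a ∈ l, a ≠ Sum.inl 1 ∧ a ≠ Sum.inr 1) ∧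
    l.Chain' (fun a b => a.isLeft ≠ b.isLeft) ∧
    (∃ g : G₁, l.head? = some (Sum.inl g)) ∧ sylProd l = x

/-- The set `P₂` of nontrivial elements of `G₁ * G₂` whose normal form begins with a
nontrivial syllable of `G₂`. -/
def beginsRight {G₁ G₂ : Type*} [Group G₁] [Group G₂] (x : Monoid.Coprod G₁ G₂) : Prop :=
  ∃ l : List (G₁ ⊕ G₂), l ≠ [] ∧ (∀ a ∈ l, a ≠ Sum.inl 1 ∧ a ≠ Sum.inr 1) ∧
    l.Chain' (fun a b => a.isLeft ≠ b.isLeft) ∧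
    (∃ h : G₂, l.head? = some (Sum.inr h)) ∧ sylProd l = x

end Perc

open Perc

namespace Perc

/-! ### Bernoulli percolation -/

open ProbabilityTheory

section Bernoulli

variable {E E' : Type*}

/-- Lebesgue measure on the unit interval, as a measure on `ℝ`. -/
noncomputable def unif : Measure ℝ := volume.restrict (Set.Icc 0 1)

instance : IsProbabilityMeasure unif := ⟨by simp [unif]⟩

/-- The threshold map turning a uniform variable into a Bernoulli variable. -/
noncomputable def threshold (p u : ℝ) : Bool := by
  classical exact decide (u < p)

lemma threshold_eq_true {p u : ℝ} : threshold p u = true ↔ u < p := by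
  simp [threshold]

lemma threshold_eq_false {p u : ℝ} : threshold p u = false ↔ p ≤ u := by
  simp [threshold]

lemma measurable_threshold (p : ℝ) : Measurable (threshold p) := by
  refine measurable_to_bool ?_
  have : threshold p ⁻¹' {true} = Set.Iio p := by
    ext u; simp [threshold_eq_true]
  rw [this]; exact measurableSet_Iio

/-- The Bernoulli distribution with parameter `p` (clamped to `[0,1]`). -/
noncomputable def coin (p : ℝ) : Measure Bool := unif.map (threshold p)

instance (p : ℝ) : IsProbabilityMeasure (coin p) :=
  Measure.isProbabilityMeasure_map (measurable_threshold p).aemeasurable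

lemma unif_Ico {p q : ℝ} (hp : 0 ≤ p) (hq : q ≤ 1) :
    unif (Set.Ico p q) = ENNReal.ofReal (q - p) := by
  rw [unif, Measure.restrict_apply measurableSet_Ico, Set.inter_eq_left.2, Real.volume_Ico]
  exact fun x hx => ⟨hp.trans hx.1, (hx.2.trans_le hq).le⟩

lemma coin_true {p : ℝ} (hp : p ∈ Set.Icc (0 : ℝ) 1) : coin p {true} = ENNReal.ofReal p := by
  rw [coin, Measure.map_apply (measurable_threshold p) (by simp), unif,
    Measure.restrict_apply (measurable_threshold p (by simp))]
  have : threshold p ⁻¹' {true} ∩ Set.Icc 0 1 = Set.Ico 0 p := by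
    ext u
    simp only [Set.mem_inter_iff, Set.mem_preimage, Set.mem_singleton_iff, threshold_eq_true,
      Set.mem_Icc, Set.mem_Ico]
    exact ⟨fun h => ⟨h.2.1, h.1⟩, fun h => ⟨h.2, h.1, h.2.le.trans hp.2⟩⟩
  rw [this, Real.volume_Ico, sub_zero]

lemma coin_singleton {p : ℝ} (hp : p ∈ Set.Icc (0 : ℝ) 1) (b : Bool) :
    coin p {b} = ENNReal.ofReal (if b then p else 1 - p) := by
  cases b with
  | true => simpa using coin_true hp
  | false =>
    have h : ({false} : Set Bool) = {true}ᶜ := by ext b; cases b <;> simp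
    rw [h, prob_compl_eq_one_sub (by simp), coin_true hp]
    simp [ENNReal.ofReal_sub _ hp.1]

/-- The Bernoulli product measure with parameter `p` (clamped to `[0,1]`). -/
noncomputable def bern (E : Type*) (p : ℝ) : Measure (Config E) :=
  Measure.infinitePi fun _ => coin p

instance (p : ℝ) : IsProbabilityMeasure (bern E p) := by unfold bern; infer_instance

lemma IsBernoulli.eq_bern {p : ℝ} (hp : p ∈ Set.Icc (0 : ℝ) 1) {μ : Measure (Config E)}
    (h : IsBernoulli p μ) : μ = bern E p := by
  classical
  refine ((Measure.isProjectiveLimit_infinitePi fun _ : E => coin p).unique fun s => ?_).symm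
  refine Measure.ext_of_singleton fun σ => ?_
  rw [Measure.map_apply (by fun_prop) (measurableSet_singleton σ), Measure.pi_singleton]
  let σ' : E → Bool := fun e => if he : e ∈ s then σ ⟨e, he⟩ else false
  have h1 : (fun ω : Config E => s.restrict (π := fun _ => Bool) ω) ⁻¹' ({σ} : Set (s → Bool)) =
      {ω : Config E | ∀ e ∈ s, ω e = σ' e} := by
    ext ω
    simp only [Set.mem_preimage, Set.mem_singleton_iff, Set.mem_ofPred_eq, funext_iff,
      Finset.restrict, Subtype.forall]
    exact forall₂_congr fun e he => by simp [σ', he]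
  rw [h1, h s σ', ← Finset.prod_attach]
  refine Finset.prod_congr (by simp) fun e _ => ?_
  rw [coin_singleton hp]
  simp [σ']

/-- The probability of the event `A` under Bernoulli percolation with parameter `p`. -/
noncomputable def Pr (p : ℝ) (A : Set (Config E)) : ℝ := (bern E p).real A

lemma Pr_nonneg (p : ℝ) (A : Set (Config E)) : 0 ≤ Pr p A := measureReal_nonneg

lemma Pr_le_one (p : ℝ) (A : Set (Config E)) : Pr p A ≤ 1 := measureReal_le_one

lemma Pr_mono (p : ℝ) {A B : Set (Config E)} (h : A ⊆ B) : Pr p A ≤ Pr p B :=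
  measureReal_mono h

lemma Pr_compl (p : ℝ) {A : Set (Config E)} (h : MeasurableSet A) : Pr p Aᶜ = 1 - Pr p A := by
  simp [Pr, measureReal_compl h]

lemma Pr_union_le (p : ℝ) (A B : Set (Config E)) : Pr p (A ∪ B) ≤ Pr p A + Pr p B :=
  measureReal_union_le A B

/-- The event `A` only depends on the states of the edges in `T`. -/
def DepOn (T : Set E) (A : Set (Config E)) : Prop :=
  ∀ ω ω' : Config E, (∀ e ∈ T, ω e = ω' e) → ω ∈ A → ω' ∈ A

lemma DepOn.mono {T T' : Set E} {A : Set (Config E)} (h : DepOn T A) (hT : T ⊆ T') :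
    DepOn T' A :=
  fun ω ω' hω => h ω ω' fun e he => hω e (hT he)

lemma DepOn.inter {T T' : Set E} {A B : Set (Config E)} (hA : DepOn T A) (hB : DepOn T' B) :
    DepOn (T ∪ T') (A ∩ B) :=
  fun ω ω' hω h => ⟨hA ω ω' (fun e he => hω e (Or.inl he)) h.1,
    hB ω ω' (fun e he => hω e (Or.inr he)) h.2⟩

lemma DepOn.measurableSet_iSup {T : Set E} {A : Set (Config E)} (h : DepOn T A)
    (hA : MeasurableSet A) :
    MeasurableSet[⨆ e ∈ T, MeasurableSpace.comap (fun ω : Config E => ω e) inferInstance] A := by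
  classical
  let k : Config E → Config E := fun ω e => if e ∈ T then ω e else false
  have hk : A = k ⁻¹' A := by
    ext ω
    exact ⟨h _ _ fun e he => by simp [k, he], h _ _ fun e he => by simp [k, he]⟩
  rw [hk]
  suffices hkm : @Measurable _ _
      (⨆ e ∈ T, MeasurableSpace.comap (fun ω : Config E => ω e) inferInstance) _ k from hkm hA
  refine @measurable_pi_lambda _ _ _
    (⨆ e ∈ T, MeasurableSpace.comap (fun ω : Config E => ω e) inferInstance) _ _ fun e => ?_
  by_cases he : e ∈ T
  · simp only [k, he, if_true]
    refine Measurable.mono (comap_measurable (fun ω : Config E => ω e)) ?_ le_rfl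
    exact le_iSup₂ (f := fun e (_ : e ∈ T) =>
      MeasurableSpace.comap (fun ω : Config E => ω e) inferInstance) e he
  · simp only [k, he, if_false]
    exact @measurable_const _ _ _
      (⨆ e ∈ T, MeasurableSpace.comap (fun ω : Config E => ω e) inferInstance) _

lemma Pr_inter {S T : Set E} (hST : Disjoint S T) {A B : Set (Config E)} (hA : MeasurableSet A)
    (hB : MeasurableSet B) (hAS : DepOn S A) (hBT : DepOn T B) (p : ℝ) :
    Pr p (A ∩ B) = Pr p A * Pr p B := by
  have hind : iIndepFun (fun (e : E) (ω : Config E) => ω e) (bern E p) :=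
    iIndepFun_infinitePi (X := fun _ b => b) fun _ => measurable_id
  have := indep_iSup_of_disjoint (fun e => (measurable_pi_apply e).comap_le) hind.iIndep hST
  rw [Indep_iff] at this
  simp only [Pr, Measure.real, this A B (hAS.measurableSet_iSup hA) (hBT.measurableSet_iSup hB),
    ENNReal.toReal_mul]

lemma Pr_open {p : ℝ} (hp : p ∈ Set.Icc (0 : ℝ) 1) (e : E) :
    Pr p {ω : Config E | ω e = true} = p := by
  have h : {ω : Config E | ω e = true} = (fun ω => ω e) ⁻¹' {true} := rfl
  rw [Pr, Measure.real, h, bern,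
    (measurePreserving_eval_infinitePi _ e).measure_preimage (by simp), coin_true hp,
    ENNReal.toReal_ofReal hp.1]

/-- An event depending only on edges on which `g` is injective has the same probability for
the configuration pulled back along `g`. -/
lemma Pr_comp {T : Set E} {A : Set (Config E)} (hT : DepOn T A) (hA : MeasurableSet A)
    {g : E → E'} (hg : Set.InjOn g T) (p : ℝ) :
    Pr p {ω : Config E' | ω ∘ g ∈ A} = Pr p A := by
  classical
  let ext : (T → Bool) → Config E := fun σ e => if he : e ∈ T then σ ⟨e, he⟩ else false
  have hext : Measurable ext := by
    refine measurable_pi_lambda _ fun e => ?_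
    by_cases he : e ∈ T
    · simp only [ext, he, dif_pos]; fun_prop
    · simp only [ext, he, dif_neg, not_false_eq_true]; fun_prop
  have key : ∀ ω : Config E, ω ∈ A ↔ ext (fun e => ω e) ∈ A := fun ω =>
    ⟨hT _ _ fun e he => by simp [ext, he], hT _ _ fun e he => by simp [ext, he]⟩
  have h1 := Measure.map_infinitePi_infinitePi_of_inj (P := fun _ : E => coin p)
    (f := ((↑) : T → E)) Subtype.val_injective
  have h2 := Measure.map_infinitePi_infinitePi_of_inj (P := fun _ : E' => coin p)
    (f := fun e : T => g e) hg.injective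
  have e1 : A = (fun (ω : Config E) (e : T) => ω e) ⁻¹' (ext ⁻¹' A) := by
    ext ω; exact key ω
  have e2 : {ω : Config E' | ω ∘ g ∈ A} =
      (fun (ω : Config E') (e : T) => ω (g e)) ⁻¹' (ext ⁻¹' A) := by
    ext ω; exact key _
  rw [e2]
  conv_rhs => rw [e1]
  simp only [Pr, Measure.real, bern]
  rw [← Measure.map_apply (by fun_prop) (hext hA), ← Measure.map_apply (by fun_prop) (hext hA),
    h1, h2]

/-- The monotone coupling of the percolation measures. -/
lemma Pr_eq_unif {A : Set (Config E)} (hA : MeasurableSet A) (p : ℝ) :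
    Pr p A = (Measure.infinitePi fun _ : E => unif).real
      {U | (fun e => threshold p (U e)) ∈ A} := by
  have h := Measure.infinitePi_map_pi (μ := fun _ : E => unif) (f := fun _ => threshold p)
    fun _ => measurable_threshold p
  have hm : Measurable fun (U : E → ℝ) e => threshold p (U e) :=
    measurable_pi_lambda _ fun e => (measurable_threshold p).comp (measurable_pi_apply e)
  rw [Pr, bern]
  simp only [coin, Measure.real]
  rw [← h, Measure.map_apply hm hA]
  rfl

/-- The event `A` is increasing. -/
def Incr (A : Set (Config E)) : Prop :=
  ∀ ω ω' : Config E, (∀ e, ω e = true → ω' e = true) → ω ∈ A → ω' ∈ A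

lemma Pr_mono_param {A : Set (Config E)} (hA : MeasurableSet A) (hi : Incr A) {p q : ℝ}
    (hpq : p ≤ q) : Pr p A ≤ Pr q A := by
  rw [Pr_eq_unif hA, Pr_eq_unif hA]
  refine measureReal_mono fun U hU => hi _ _ (fun e he => ?_) hU
  rw [threshold_eq_true] at he ⊢
  exact he.trans_le hpq

lemma Pr_le_add_of_depOn {A : Set (Config E)} (hA : MeasurableSet A) (F : Finset E)
    (hF : DepOn (F : Set E) A) {p q : ℝ} (hp : 0 ≤ p) (hq : q ≤ 1) (hpq : p ≤ q) :
    Pr q A ≤ Pr p A + F.card * (q - p) := by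
  rw [Pr_eq_unif hA, Pr_eq_unif hA]
  have hsub : {U : E → ℝ | (fun e => threshold q (U e)) ∈ A} ⊆
      {U : E → ℝ | (fun e => threshold p (U e)) ∈ A} ∪
        ⋃ e ∈ F, {U : E → ℝ | U e ∈ Set.Ico p q} := by
    intro U hU
    by_contra hcon
    simp only [Set.mem_union, Set.mem_iUnion, Set.mem_ofPred_eq, Set.mem_Ico, not_or, not_exists,
      not_and, not_lt] at hcon
    refine hcon.1 (hF _ _ (fun e he => ?_) hU)
    have h2 := hcon.2 e he
    rw [Bool.eq_iff_iff, threshold_eq_true, threshold_eq_true]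
    exact ⟨fun h => not_le.1 fun h' => absurd h (h2 h').not_gt, fun h => h.trans_le hpq⟩
  have hI : ∀ e : E, (Measure.infinitePi fun _ : E => unif).real {U : E → ℝ | U e ∈ Set.Ico p q}
      = q - p := fun e => by
    have h : {U : E → ℝ | U e ∈ Set.Ico p q} = (fun U => U e) ⁻¹' Set.Ico p q := rfl
    rw [Measure.real, h,
      (measurePreserving_eval_infinitePi (fun _ : E => unif) e).measure_preimage
        measurableSet_Ico.nullMeasurableSet, unif_Ico hp hq,
      ENNReal.toReal_ofReal (sub_nonneg.2 hpq)]
  refine (measureReal_mono hsub).trans ((measureReal_union_le _ _).trans ?_)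
  gcongr
  refine (measureReal_biUnion_finset_le _ _).trans ?_
  rw [Finset.sum_congr rfl fun e _ => hI e, Finset.sum_const, nsmul_eq_mul]

/-- Quantitative strict monotonicity in `p`, for an increasing event `A` which occurs as soon as
`e` is open and fails when `e` and all edges of `F` are closed. -/
lemma Pr_add_le_of_incr {A : Set (Config E)} (hA : MeasurableSet A) (hi : Incr A) {p q : ℝ}
    (hp : 0 ≤ p) (hpq : p ≤ q) (hq : q ≤ 1) {e : E} {F : Finset E} (heF : e ∉ F)
    (h1 : ∀ ω : Config E, ω e = true → ω ∈ A)
    (h2 : ∀ ω : Config E, ω e = false → (∀ f ∈ F, ω f = false) → ω ∉ A) :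
    Pr p A + (q - p) * (1 - q) ^ F.card ≤ Pr q A := by
  classical
  rw [Pr_eq_unif hA, Pr_eq_unif hA]
  set D : Set (E → ℝ) := Set.pi (insert e F : Finset E)
    fun f => if f = e then Set.Ico p q else Set.Ici q with hD
  have hDmeas : MeasurableSet D := by
    refine MeasurableSet.pi (Finset.countable_toSet _) fun f _ => ?_
    split_ifs
    · exact measurableSet_Ico
    · exact measurableSet_Ici
  have hIci : unif (Set.Ici q) = ENNReal.ofReal (1 - q) := by
    rw [unif, Measure.restrict_apply measurableSet_Ici]
    have : Set.Ici q ∩ Set.Icc 0 1 = Set.Icc q 1 := by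
      ext u
      simp only [Set.mem_inter_iff, Set.mem_Ici, Set.mem_Icc]
      exact ⟨fun h => ⟨h.1, h.2.2⟩, fun h => ⟨h.1, hp.trans (hpq.trans h.1), h.2⟩⟩
    rw [this, Real.volume_Icc]
  have hDval : (Measure.infinitePi fun _ : E => unif).real D = (q - p) * (1 - q) ^ F.card := by
    rw [Measure.real, hD, Measure.infinitePi_pi, Finset.prod_insert heF]
    · rw [if_pos rfl, unif_Ico hp hq, Finset.prod_congr rfl (g := fun _ => ENNReal.ofReal (1 - q)),
        Finset.prod_const, ENNReal.toReal_mul, ENNReal.toReal_pow,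
        ENNReal.toReal_ofReal (sub_nonneg.2 hpq), ENNReal.toReal_ofReal (sub_nonneg.2 hq)]
      intro f hf
      have hfe : f ≠ e := fun h => heF (h ▸ hf)
      rw [if_neg hfe, hIci]
    · intro f _
      split_ifs
      · exact measurableSet_Ico
      · exact measurableSet_Ici
  rw [← hDval, ← measureReal_union _ hDmeas]
  · refine measureReal_mono (Set.union_subset (fun U hU => ?_) fun U hU => ?_)
    · refine hi _ _ (fun f hf => ?_) hU
      rw [threshold_eq_true] at hf ⊢
      exact hf.trans_le hpq
    · refine h1 _ ?_
      have := hU e (by simp)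
      simp only [if_true] at this
      exact threshold_eq_true.2 this.2
  · rw [Set.disjoint_left]
    intro U hU hUD
    refine h2 _ ?_ (fun f hf => ?_) hU
    · have := hUD e (by simp)
      simp only [if_true] at this
      exact threshold_eq_false.2 this.1
    · have := hUD f (by simp [hf])
      have hfe : f ≠ e := fun h => heF (h ▸ hf)
      simp only [if_neg hfe] at this
      exact threshold_eq_false.2 (hpq.trans this)

end Bernoulli

/-! ### Connection events -/

section Connection

variable {K ι : Type*} [Group K] {f : ι → K} {t : ι → Bool}

lemma Step.symm {ω : Config (K × ι)} {a b : K} (h : Step f ω a b) : Step f ω b a := by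
  obtain ⟨i, h | h⟩ := h
  exacts [⟨i, Or.inr h⟩, ⟨i, Or.inl h⟩]

lemma Conn.symm {ω : Config (K × ι)} {a b : K} (h : Conn f ω a b) : Conn f ω b a := by
  induction h with
  | refl => exact Relation.ReflTransGen.refl
  | tail _ h ih => exact ih.head h.symm

lemma Step.mono {ω ω' : Config (K × ι)} (hω : ∀ e, ω e = true → ω' e = true) {a b : K}
    (h : Step f ω a b) : Step f ω' a b := by
  obtain ⟨i, h | h⟩ := h
  exacts [⟨i, Or.inl ⟨hω _ h.1, h.2⟩⟩, ⟨i, Or.inr ⟨hω _ h.1, h.2⟩⟩]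

lemma Conn.mono {ω ω' : Config (K × ι)} (hω : ∀ e, ω e = true → ω' e = true) {a b : K}
    (h : Conn f ω a b) : Conn f ω' a b :=
  Relation.ReflTransGen.mono (fun _ _ => Step.mono hω) _ _ h

lemma measurableSet_step [Countable ι] (a b : K) :
    MeasurableSet {ω : Config (K × ι) | Step f ω a b} := by
  have h : {ω : Config (K × ι) | Step f ω a b} =
      ⋃ i, ({ω | ω (a, i) = true} ∩ {_ω | b = a * f i}) ∪
        ({ω | ω (b, i) = true} ∩ {_ω | a = b * f i}) := by
    ext ω; simp [Step]
  rw [h]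
  have ho : ∀ e : K × ι, MeasurableSet {ω : Config (K × ι) | ω e = true} := fun e =>
    (measurable_pi_apply (X := fun _ => Bool) e : Measurable fun ω : Config (K × ι) => ω e)
      (measurableSet_singleton true)
  exact MeasurableSet.iUnion fun i =>
    ((ho _).inter (MeasurableSet.const _)).union ((ho _).inter (MeasurableSet.const _))

lemma measurableSet_conn [Countable ι] [Countable K] (x y : K) :
    MeasurableSet {ω : Config (K × ι) | Conn f ω x y} := by
  have key : ∀ (n : ℕ) (y : K), MeasurableSet {ω : Config (K × ι) |
      ∃ g : ℕ → K, g 0 = x ∧ g n = y ∧ ∀ k < n, Step f ω (g k) (g (k + 1))} := by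
    intro n
    induction n with
    | zero =>
      intro y
      by_cases hxy : x = y
      · have : {ω : Config (K × ι) | ∃ g : ℕ → K, g 0 = x ∧ g 0 = y ∧
            ∀ k < 0, Step f ω (g k) (g (k + 1))} = Set.univ := by
          ext ω
          simpa using ⟨fun _ => x, rfl, hxy⟩
        rw [this]; exact MeasurableSet.univ
      · have : {ω : Config (K × ι) | ∃ g : ℕ → K, g 0 = x ∧ g 0 = y ∧
            ∀ k < 0, Step f ω (g k) (g (k + 1))} = ∅ := by
          ext ω
          simp only [Set.mem_ofPred_eq, Set.mem_empty_iff_false, iff_false]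
          rintro ⟨g, h1, h2, -⟩
          exact hxy (h1.symm.trans h2)
        rw [this]; exact MeasurableSet.empty
    | succ n ih =>
      intro y
      have : {ω : Config (K × ι) | ∃ g : ℕ → K, g 0 = x ∧ g (n + 1) = y ∧
            ∀ k < n + 1, Step f ω (g k) (g (k + 1))} =
          ⋃ z : K, {ω : Config (K × ι) | ∃ g : ℕ → K, g 0 = x ∧ g n = z ∧
            ∀ k < n, Step f ω (g k) (g (k + 1))} ∩ {ω | Step f ω z y} := by
        ext ω
        simp only [Set.mem_ofPred_eq, Set.mem_iUnion, Set.mem_inter_iff]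
        constructor
        · rintro ⟨g, h0, h1, h2⟩
          exact ⟨g n, ⟨g, h0, rfl, fun k hk => h2 k (by omega)⟩, h1 ▸ h2 n (by omega)⟩
        · rintro ⟨z, ⟨g, h0, h1, h2⟩, h3⟩
          refine ⟨fun k => if k ≤ n then g k else y, by simpa using h0, by simp, fun k hk => ?_⟩
          rcases Nat.lt_succ_iff_lt_or_eq.1 hk with hk | rfl
          · simpa [hk.le, Nat.succ_le_iff.2 hk] using h2 k hk
          · simpa [h1] using h3
      rw [this]
      exact MeasurableSet.iUnion fun z => (ih z).inter (measurableSet_step z y)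
  have : {ω : Config (K × ι) | Conn f ω x y} = ⋃ n : ℕ, {ω : Config (K × ι) |
      ∃ g : ℕ → K, g 0 = x ∧ g n = y ∧ ∀ k < n, Step f ω (g k) (g (k + 1))} := by
    ext ω
    simp only [Set.mem_ofPred_eq, Set.mem_iUnion]
    constructor
    · intro h
      induction h with
      | refl => exact ⟨0, fun _ => x, rfl, rfl, by simp⟩
      | @tail z y _ h3 ih =>
        obtain ⟨n, g, h0, h1, h2⟩ := ih
        refine ⟨n + 1, fun k => if k ≤ n then g k else y, by simpa using h0, by simp,
          fun k hk => ?_⟩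
        rcases Nat.lt_succ_iff_lt_or_eq.1 hk with hk | rfl
        · simpa [hk.le, Nat.succ_le_iff.2 hk] using h2 k hk
        · simpa [h1] using h3
    · rintro ⟨n, g, h0, h1, h2⟩
      have : ∀ k ≤ n, Conn f ω x (g k) := by
        intro k
        induction k with
        | zero => intro _; rw [h0]; exact Relation.ReflTransGen.refl
        | succ k ih => exact fun hk => (ih (by omega)).tail (h2 k (by omega))
      exact h1 ▸ this n le_rfl
  rw [this]
  exact MeasurableSet.iUnion fun n => key n y

/-- The configuration obtained from `ω` by closing all edges outside `T`. -/
noncomputable def mask {E : Type*} (T : Set E) (ω : Config E) : Config E := by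
  classical exact fun e => ω e && decide (e ∈ T)

lemma mask_eq_true {E : Type*} {T : Set E} {ω : Config E} {e : E} :
    mask T ω e = true ↔ ω e = true ∧ e ∈ T := by
  simp [mask]

lemma mask_univ {E : Type*} (ω : Config E) : mask Set.univ ω = ω := by
  ext e; simp [mask]

lemma measurable_mask {E : Type*} (T : Set E) : Measurable (mask T : Config E → Config E) := by
  classical
  refine measurable_pi_lambda _ fun e => ?_
  by_cases he : e ∈ T
  · simpa [mask, he] using measurable_pi_apply e
  · simp [mask, he]

/-- The event that `x` and `y` are joined by an open path with edges in `T`. -/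
def conn (f : ι → K) (T : Set (K × ι)) (x y : K) : Set (Config (K × ι)) :=
  {ω | Conn f (mask T ω) x y}

lemma mem_conn {T : Set (K × ι)} {x y : K} {ω : Config (K × ι)} :
    ω ∈ conn f T x y ↔ Conn f (mask T ω) x y := Iff.rfl

lemma measurableSet_conn_mask [Countable ι] [Countable K] (T : Set (K × ι)) (x y : K) :
    MeasurableSet (conn f T x y) :=
  measurable_mask T (measurableSet_conn x y)

lemma depOn_conn (T : Set (K × ι)) (x y : K) : DepOn T (conn f T x y) := by
  intro ω ω' h hω
  have : mask T ω = mask T ω' := by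
    ext e
    rw [Bool.eq_iff_iff, mask_eq_true, mask_eq_true]
    exact and_congr_left fun he => by rw [h e he]
  rw [mem_conn] at hω ⊢
  rwa [← this]

lemma incr_conn (T : Set (K × ι)) (x y : K) : Incr (conn f T x y) := fun _ _ h hω =>
  Conn.mono (fun _ he => mask_eq_true.2 ((mask_eq_true.1 he).imp_left (h _))) hω

lemma conn_mono {T T' : Set (K × ι)} (h : T ⊆ T') (x y : K) : conn f T x y ⊆ conn f T' x y :=
  fun _ hω => Conn.mono (fun _ he => mask_eq_true.2 ((mask_eq_true.1 he).imp_right (h ·))) hω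

lemma Conn.map {K' ι' : Type*} [Group K'] {f' : ι' → K'} {F : K → K'} {π : ι → ι'}
    (hF : ∀ a s, F (a * f s) = F a * f' (π s)) {ω : Config (K × ι)} {ω' : Config (K' × ι')}
    (h : ∀ a s, ω (a, s) = true → ω' (F a, π s) = true) {x y : K} (hxy : Conn f ω x y) :
    Conn f' ω' (F x) (F y) := by
  refine Relation.ReflTransGen.lift F ?_ _ _ hxy
  rintro a b ⟨s, h' | h'⟩
  · exact ⟨π s, Or.inl ⟨h _ _ h'.1, by rw [h'.2, hF]⟩⟩
  · exact ⟨π s, Or.inr ⟨h _ _ h'.1, by rw [h'.2, hF]⟩⟩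

/-- Comparison of connection probabilities under a graph homomorphism which is injective on the
relevant edges. -/
lemma Pr_conn_le_of_map [Countable ι] [Countable K] {K' ι' : Type*} [Group K'] {f' : ι' → K'}
    {F : K → K'} {π : ι → ι'} (hF : ∀ a s, F (a * f s) = F a * f' (π s))
    {T : Set (K × ι)} {T' : Set (K' × ι')} (hinj : Set.InjOn (Prod.map F π) T)
    (hT : ∀ a s, (a, s) ∈ T → (F a, π s) ∈ T') (p : ℝ) (x y : K) :
    Pr p (conn f T x y) ≤ Pr p (conn f' T' (F x) (F y)) := by
  rw [← Pr_comp (depOn_conn T x y) (measurableSet_conn_mask T x y) hinj p]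
  refine Pr_mono p fun ω hω => Conn.map hF (fun a s h => ?_) hω
  rw [mask_eq_true] at h ⊢
  exact ⟨h.1, hT _ _ h.2⟩

/-- The edges of type `i` both of whose endpoints lie in `u * V`. -/
def copy (f : ι → K) (t : ι → Bool) (i : Bool) (u : K) (V : Set K) : Set (K × ι) :=
  {e | t e.2 = i ∧ u⁻¹ * e.1 ∈ V ∧ u⁻¹ * (e.1 * f e.2) ∈ V}

lemma mem_copy {i : Bool} {u : K} {V : Set K} {a : K} {s : ι} :
    (a, s) ∈ copy f t i u V ↔ t s = i ∧ u⁻¹ * a ∈ V ∧ u⁻¹ * (a * f s) ∈ V := Iff.rfl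

lemma copy_mono {i : Bool} {u : K} {V V' : Set K} (h : V ⊆ V') :
    copy f t i u V ⊆ copy f t i u V' := fun _ he => ⟨he.1, h he.2.1, h he.2.2⟩

lemma Pr_conn_copy_translate_le [Countable ι] [Countable K] (i : Bool) (v u : K) (V : Set K)
    (p : ℝ) (x y : K) :
    Pr p (conn f (copy f t i u V) x y) ≤ Pr p (conn f (copy f t i (v * u) V) (v * x) (v * y)) := by
  refine Pr_conn_le_of_map (F := fun a => v * a) (π := id) (fun a s => mul_assoc _ _ _ |>.symm)
    (fun e _ e' _ h => ?_) (fun a s h => ?_) p x y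
  · simp only [Prod.map, id, Prod.mk.injEq, mul_right_inj] at h
    exact Prod.ext h.1 h.2
  · rw [mem_copy] at h ⊢
    simpa [mul_assoc] using h

lemma Pr_conn_copy_translate [Countable ι] [Countable K] (i : Bool) (u : K) (V : Set K)
    (p : ℝ) (x y : K) :
    Pr p (conn f (copy f t i u V) (u * x) (u * y)) = Pr p (conn f (copy f t i 1 V) x y) := by
  refine le_antisymm ?_ ?_
  · simpa using Pr_conn_copy_translate_le (f := f) (t := t) i u⁻¹ u V p (u * x) (u * y)
  · simpa using Pr_conn_copy_translate_le (f := f) (t := t) i u 1 V p x y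

/-- The probability that `1` and `g` are joined by an open path of edges of type `i` inside
`V`. -/
noncomputable def tau (f : ι → K) (t : ι → Bool) (p : ℝ) (i : Bool) (V : Set K) (g : K) : ℝ :=
  Pr p (conn f (copy f t i 1 V) 1 g)

lemma tau_nonneg (p : ℝ) (i : Bool) (V : Set K) (g : K) : 0 ≤ tau f t p i V g := Pr_nonneg _ _

lemma tau_le_one (p : ℝ) (i : Bool) (V : Set K) (g : K) : tau f t p i V g ≤ 1 := Pr_le_one _ _

lemma tau_mono_set (p : ℝ) (i : Bool) {V V' : Set K} (h : V ⊆ V') (g : K) :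
    tau f t p i V g ≤ tau f t p i V' g :=
  Pr_mono p (conn_mono (copy_mono h) 1 g)

lemma tau_mono_param [Countable ι] [Countable K] {p q : ℝ} (hpq : p ≤ q) (i : Bool) (V : Set K)
    (g : K) : tau f t p i V g ≤ tau f t q i V g :=
  Pr_mono_param (measurableSet_conn_mask _ _ _) (incr_conn _ _ _) hpq

lemma Pr_conn_copy [Countable ι] [Countable K] (p : ℝ) (i : Bool) (u : K) (V : Set K) (g : K) :
    Pr p (conn f (copy f t i u V) u (u * g)) = tau f t p i V g := by
  simpa [tau] using Pr_conn_copy_translate (f := f) (t := t) i u V p 1 g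

lemma Pr_conn_copy_univ [Countable ι] [Countable K] (p : ℝ) (i : Bool) (x y : K) :
    Pr p (conn f (copy f t i 1 Set.univ) x y) = tau f t p i Set.univ (x⁻¹ * y) := by
  rw [← Pr_conn_copy p i x Set.univ (x⁻¹ * y), mul_inv_cancel_left]
  simp [copy]

lemma tau_le_add [Finite ι] [Countable K] (i : Bool) {V : Set K} (hV : V.Finite) :
    ∃ N : ℝ, 0 ≤ N ∧ ∀ p q : ℝ, 0 ≤ p → q ≤ 1 → p ≤ q → ∀ g,
      tau f t q i V g ≤ tau f t p i V g + N * (q - p) := by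
  have hfin : (V ×ˢ (Set.univ : Set ι)).Finite := hV.prod Set.finite_univ
  refine ⟨hfin.toFinset.card, by positivity, fun p q hp hq hpq g =>
    Pr_le_add_of_depOn (measurableSet_conn_mask _ _ _) _ ((depOn_conn _ _ _).mono ?_) hp hq hpq⟩
  rintro ⟨a, s⟩ h
  rw [mem_copy] at h
  simpa using h.2.1

lemma conn_copy_mem {i : Bool} {u : K} {V : Set K} {ω : Config (K × ι)} {x y : K}
    (hx : u⁻¹ * x ∈ V) (h : Conn f (mask (copy f t i u V) ω) x y) : u⁻¹ * y ∈ V := by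
  induction h with
  | refl => exact hx
  | tail _ h _ =>
    obtain ⟨s, h | h⟩ := h
    · rw [h.2]; exact (mask_eq_true.1 h.1).2.2.2
    · exact (mask_eq_true.1 h.1).2.2.1

lemma tau_eq_zero {p : ℝ} {i : Bool} {V : Set K} {g : K} (h1 : (1 : K) ∈ V) (hg : g ∉ V) :
    tau f t p i V g = 0 := by
  have : conn f (copy f t i 1 V) 1 g = ∅ := by
    ext ω
    simp only [Set.mem_empty_iff_false, iff_false]
    intro h
    exact hg (by simpa using conn_copy_mem (u := 1) (by simpa using h1) h)
  rw [tau, this]; simp [Pr]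

/-- The event that the cluster of the identity has at least `n` elements. -/
def sizeEv (f : ι → K) (n : ℕ) : Set (Config (K × ι)) :=
  {ω | ∃ Λ : Finset K, Λ.card = n ∧ ∀ x ∈ Λ, Conn f ω 1 x}

lemma sizeEv_anti {m n : ℕ} (h : m ≤ n) : sizeEv f n ⊆ sizeEv f m := by
  rintro ω ⟨Λ, rfl, hΛ⟩
  obtain ⟨Λ', h1, h2⟩ := Finset.exists_subset_card_eq h
  exact ⟨Λ', h2, fun x hx => hΛ x (h1 hx)⟩

lemma measurableSet_sizeEv [Countable ι] [Countable K] (n : ℕ) :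
    MeasurableSet (sizeEv f n : Set (Config (K × ι))) := by
  have : (sizeEv f n : Set (Config (K × ι))) = ⋃ Λ : Finset K, ⋃ _ : Λ.card = n,
      ⋂ x ∈ Λ, {ω | Conn f ω 1 x} := by
    ext ω; simp [sizeEv]
  rw [this]
  exact MeasurableSet.iUnion fun Λ => MeasurableSet.iUnion fun _ =>
    Finset.measurableSet_biInter _ fun x _ => measurableSet_conn _ _

lemma cluster_infinite_iff {ω : Config (K × ι)} :
    (cluster f ω).Infinite ↔ ∀ n, ω ∈ sizeEv f n := by
  constructor
  · intro h n
    obtain ⟨Λ, h1, h2⟩ := h.exists_subset_card_eq n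
    exact ⟨Λ, h2, fun x hx => h1 hx⟩
  · intro h hfin
    obtain ⟨Λ, h1, h2⟩ := h (hfin.toFinset.card + 1)
    have : Λ ⊆ hfin.toFinset := fun x hx => hfin.mem_toFinset.2 (h2 x hx)
    have := Finset.card_le_card this
    omega

lemma theta_le_sizeEv (p : ℝ) (n : ℕ) : theta f (bern (K × ι) p) ≤ Pr p (sizeEv f n) :=
  Pr_mono p fun _ hω => cluster_infinite_iff.1 hω n

lemma le_theta [Countable ι] [Countable K] {p x : ℝ} (h : ∀ n, x ≤ Pr p (sizeEv f n)) :
    x ≤ theta f (bern (K × ι) p) := by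
  have h1 : {ω : Config (K × ι) | (cluster f ω).Infinite} = ⋂ n, sizeEv f n := by
    ext ω; simp [cluster_infinite_iff]
  have h2 : theta f (bern (K × ι) p) = (bern (K × ι) p).real (⋂ n, sizeEv f n) := by
    rw [← h1]; rfl
  rw [h2]
  have h3 := tendsto_measure_iInter_atTop (μ := bern (K × ι) p) (s := sizeEv f)
    (fun n => (measurableSet_sizeEv n).nullMeasurableSet) (fun _ _ h => sizeEv_anti h)
    ⟨0, measure_ne_top _ _⟩
  exact ge_of_tendsto' ((ENNReal.tendsto_toReal (measure_ne_top _ _)).comp h3) h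

lemma theta_eq_Pr (p : ℝ) :
    theta f (bern (K × ι) p) = Pr p {ω : Config (K × ι) | (cluster f ω).Infinite} := rfl

end Connection

/-! ### Percolation on quotients -/

section Quotient

/-- The configuration `ω` with the edges of `O` opened and those of `C` closed. -/
def setEdges {E : Type*} [DecidableEq E] (O C : Finset E) (ω : Config E) : Config E :=
  fun e => if e ∈ O then true else if e ∈ C then false else ω e

lemma setEdges_empty {E : Type*} [DecidableEq E] (ω : Config E) : setEdges ∅ ∅ ω = ω :=
  funext fun e => by simp [setEdges]

lemma measurable_setEdges {E : Type*} [DecidableEq E] (O C : Finset E) :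
    Measurable (setEdges O C : Config E → Config E) := by
  refine measurable_pi_lambda _ fun e => ?_
  unfold setEdges
  split_ifs
  · exact measurable_const
  · exact measurable_const
  · exact measurable_pi_apply e

/-- Conditioning on the state of a single edge. -/
lemma Pr_setEdges_split {E : Type*} [DecidableEq E] {p : ℝ} (hp : p ∈ Set.Icc (0 : ℝ) 1)
    {O C : Finset E} {e : E}
    (hO : e ∉ O) (hC : e ∉ C) {S : Set (Config E)} (hS : MeasurableSet S) :
    Pr p {ω | setEdges O C ω ∈ S} = p * Pr p {ω | setEdges (insert e O) C ω ∈ S} +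
      (1 - p) * Pr p {ω | setEdges O (insert e C) ω ∈ S} := by
  have hm : ∀ O C : Finset E, MeasurableSet {ω | setEdges O C ω ∈ S} := fun O C =>
    measurable_setEdges O C hS
  have ho : MeasurableSet {ω : Config E | ω e = true} :=
    (measurable_pi_apply (X := fun _ => Bool) e : Measurable fun ω : Config E => ω e)
      (measurableSet_singleton true)
  have hod : DepOn {e} {ω : Config E | ω e = true} := fun ω ω' h hω => by
    have := h e rfl
    simp only [Set.mem_ofPred_eq] at hω ⊢
    rw [← this, hω]
  have hdep : ∀ O C : Finset E, e ∈ O ∨ e ∈ C → DepOn {e}ᶜ {ω | setEdges O C ω ∈ S} := by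
    intro O C heOC ω ω' h hω
    have : setEdges O C ω' = setEdges O C ω := by
      ext g
      by_cases hg : g = e
      · subst hg; simp only [setEdges]; split_ifs <;> simp_all
      · simp only [setEdges]; rw [h g hg]
    simpa only [Set.mem_ofPred_eq, this] using hω
  have hsplit : Pr p {ω | setEdges O C ω ∈ S} =
      Pr p ({ω | setEdges O C ω ∈ S} ∩ {ω | ω e = true}) +
        Pr p ({ω | setEdges O C ω ∈ S} \ {ω | ω e = true}) :=
    (measureReal_inter_add_sdiff ho).symm
  have e1 : {ω | setEdges O C ω ∈ S} ∩ {ω | ω e = true} =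
      {ω : Config E | ω e = true} ∩ {ω | setEdges (insert e O) C ω ∈ S} := by
    ext ω
    simp only [Set.mem_inter_iff, Set.mem_ofPred_eq]
    rw [and_comm]
    refine and_congr_right fun h => ?_
    have : setEdges O C ω = setEdges (insert e O) C ω := by
      ext g
      by_cases hg : g = e
      · subst hg; simp [setEdges, hO, hC, h]
      · simp [setEdges, hg]
    rw [this]
  have e2 : {ω | setEdges O C ω ∈ S} \ {ω | ω e = true} =
      {ω : Config E | ω e = true}ᶜ ∩ {ω | setEdges O (insert e C) ω ∈ S} := by
    ext ω
    simp only [Set.mem_inter_iff, Set.mem_ofPred_eq, Set.mem_sdiff, Set.mem_compl_iff,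
      Bool.not_eq_true]
    rw [and_comm]
    refine and_congr_right fun h => ?_
    have : setEdges O C ω = setEdges O (insert e C) ω := by
      ext g
      by_cases hg : g = e
      · subst hg; simp [setEdges, hO, h]
      · simp [setEdges, hg]
    rw [this]
  have hodc : DepOn {e} {ω : Config E | ω e = true}ᶜ := fun ω ω' h hω hω' =>
    hω (hod ω' ω (fun g hg => (h g hg).symm) hω')
  rw [hsplit, e1, e2, Pr_inter disjoint_compl_right ho (hm _ _) hod (hdep _ _ (by simp)),
    Pr_inter disjoint_compl_right ho.compl (hm _ _) hodc (hdep _ _ (by simp)),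
    Pr_compl p ho, Pr_open hp]

variable {G H ι : Type*} [Group G] [Group H] [Fintype ι] [Countable G] [Countable H]

omit [Fintype ι] [Countable G] in
lemma Pr_setEdges_sizeEv_eq_one [DecidableEq G] [DecidableEq ι] (f : ι → G)
    {p : ℝ} {n : ℕ} {A : Finset G}
    {OG CG : Finset (G × ι)}
    (hconn : ∀ ω : Config (G × ι), (∀ e ∈ OG, ω e = true) → ∀ x ∈ A, Conn f ω 1 x)
    (hnA : n ≤ A.card) : Pr p {ω | setEdges OG CG ω ∈ sizeEv f n} = 1 := by
  have : {ω : Config (G × ι) | setEdges OG CG ω ∈ sizeEv f n} = Set.univ := by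
    refine Set.eq_univ_of_forall fun ω => sizeEv_anti hnA ⟨A, rfl, hconn _ fun e he => ?_⟩
    simp [setEdges, he]
  simp [this, Pr]

omit [Fintype ι] [Countable G] [Countable H] in
lemma Pr_setEdges_sizeEv_eq_zero [DecidableEq H] [DecidableEq ι] (f : ι → G) (F : G →* H)
    {p : ℝ} {n : ℕ} {A : Finset G}
    {O C : Finset (H × ι)} (hA1 : 1 ∈ A)
    (hO : ∀ e ∈ O, e.1 ∈ A.image F ∧ e.1 * F (f e.2) ∈ A.image F) (hnA : A.card < n)
    (hall : ∀ a ∈ A, ∀ b ∉ A, F b ∉ A.image F → ∀ e : G × ι,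
      (e.1 = a ∧ b = a * f e.2 ∨ e.1 = b ∧ a = b * f e.2) → (F e.1, e.2) ∈ C) :
    Pr p {ω | setEdges O C ω ∈ sizeEv (fun s => F (f s)) n} = 0 := by
  have : {ω : Config (H × ι) | setEdges O C ω ∈ sizeEv (fun s => F (f s)) n} = ∅ := by
    ext ω
    simp only [Set.mem_ofPred_eq, Set.mem_empty_iff_false, iff_false]
    rintro ⟨Λ, rfl, hΛ⟩
    have hsub : Λ ⊆ A.image F := by
      intro x hx
      have hx := hΛ x hx
      clear * - hx hall hA1 hO
      induction hx with
      | refl => exact Finset.mem_image.2 ⟨1, hA1, map_one F⟩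
      | @tail y z _ hyz hy =>
        by_contra hz
        obtain ⟨a, ha, rfl⟩ := Finset.mem_image.1 hy
        obtain ⟨s, ⟨h1, rfl⟩ | ⟨h1, h2⟩⟩ := hyz
        · have hb : F (a * f s) ∉ A.image F := by simpa using hz
          have := hall a ha (a * f s) (fun h => hb (Finset.mem_image_of_mem F h)) hb (a, s)
            (Or.inl ⟨rfl, rfl⟩)
          have hO' : (F a, s) ∉ O := fun h => hz (by simpa using (hO _ h).2)
          simp [setEdges, hO', this] at h1
        · obtain rfl : z = F (a * (f s)⁻¹) := by simp [h2]
          have := hall a ha (a * (f s)⁻¹) (fun h => hz (Finset.mem_image_of_mem F h)) hz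
            (a * (f s)⁻¹, s) (Or.inr ⟨rfl, by simp⟩)
          have hO' : (F (a * (f s)⁻¹), s) ∉ O := fun h => hz (hO _ h).1
          simp [-map_mul, setEdges, hO', this] at h1
    have := (Finset.card_le_card hsub).trans Finset.card_image_le
    omega
  simp [this, Pr]

lemma Pr_sizeEv_explore [DecidableEq G] [DecidableEq H] [DecidableEq ι] (f : ι → G) (F : G →* H)
    {p : ℝ} (hp : p ∈ Set.Icc (0 : ℝ) 1) (n N : ℕ)
    (A : Finset G) (O C : Finset (H × ι)) (OG CG : Finset (G × ι))
    (hA1 : 1 ∈ A) (hinj : Set.InjOn F A)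
    (hconn : ∀ ω : Config (G × ι), (∀ e ∈ OG, ω e = true) → ∀ x ∈ A, Conn f ω 1 x)
    (hG : ∀ e ∈ OG ∪ CG, (F e.1, e.2) ∈ O ∪ C)
    (hO : ∀ e ∈ O, e.1 ∈ A.image F ∧ e.1 * F (f e.2) ∈ A.image F)
    (hC : C ⊆ (A ×ˢ (Finset.univ : Finset ι)).image (fun x => (F x.1, x.2)) ∪
      (A ×ˢ (Finset.univ : Finset ι)).image (fun x => (F x.1 * (F (f x.2))⁻¹, x.2)))
    (hN : n * (1 + 2 * Fintype.card ι) ≤ N + A.card + C.card) :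
    Pr p {ω | setEdges O C ω ∈ sizeEv (fun s => F (f s)) n} ≤
      Pr p {ω | setEdges OG CG ω ∈ sizeEv f n} := by
  induction N generalizing A O C OG CG with
  | zero =>
    suffices h : n ≤ A.card by
      rw [Pr_setEdges_sizeEv_eq_one f hconn h]; exact Pr_le_one _ _
    have h1 := (Finset.card_le_card hC).trans (Finset.card_union_le _ _)
    have h2 := Finset.card_image_le (s := A ×ˢ (Finset.univ : Finset ι))
      (f := fun x => (F x.1, x.2))
    have h3 := Finset.card_image_le (s := A ×ˢ (Finset.univ : Finset ι))
      (f := fun x => (F x.1 * (F (f x.2))⁻¹, x.2))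
    rw [Finset.card_product, Finset.card_univ] at h2 h3
    by_contra h
    have h4 : (A.card + 1) * (1 + 2 * Fintype.card ι) ≤ n * (1 + 2 * Fintype.card ι) :=
      Nat.mul_le_mul_right _ (by omega)
    nlinarith
  | succ N ih =>
    by_cases hnA : n ≤ A.card
    · rw [Pr_setEdges_sizeEv_eq_one f hconn hnA]; exact Pr_le_one _ _
    by_cases hall : ∀ a ∈ A, ∀ b ∉ A, F b ∉ A.image F → ∀ e : G × ι,
      (e.1 = a ∧ b = a * f e.2 ∨ e.1 = b ∧ a = b * f e.2) → (F e.1, e.2) ∈ C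
    · rw [Pr_setEdges_sizeEv_eq_zero f F hA1 hO (not_le.1 hnA) hall]; exact Pr_nonneg _ _
    push Not at hall
    obtain ⟨a, ha, b, hb, hFb, e, he, heC⟩ := hall
    have hb1 : F b ∈ (insert b A).image F := Finset.mem_image_of_mem F (Finset.mem_insert_self _ _)
    have ha1 : F a ∈ (insert b A).image F :=
      Finset.mem_image_of_mem F (Finset.mem_insert_of_mem ha)
    have heO : (F e.1, e.2) ∉ O := by
      intro h
      have := hO _ h
      rcases he with ⟨h1, h2⟩ | ⟨h1, h2⟩
      · refine hFb ?_
        rw [h2]; simpa [h1] using this.2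
      · refine hFb ?_
        simpa [h1] using this.1
    have heG : e ∉ OG ∪ CG := fun h =>
      (Finset.mem_union.1 (hG e h)).elim heO heC
    rw [Finset.notMem_union] at heG
    have heT : (F e.1, e.2) ∈ (A ×ˢ (Finset.univ : Finset ι)).image (fun x => (F x.1, x.2)) ∪
        (A ×ˢ (Finset.univ : Finset ι)).image (fun x => (F x.1 * (F (f x.2))⁻¹, x.2)) := by
      rcases he with ⟨h1, -⟩ | ⟨h1, h2⟩
      · exact Finset.mem_union_left _ (Finset.mem_image.2 ⟨(a, e.2), by simp [ha], by simp [h1]⟩)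
      · refine Finset.mem_union_right _ (Finset.mem_image.2 ⟨(a, e.2), by simp [ha], ?_⟩)
        simp [h1, h2]
    rw [Pr_setEdges_split hp heO heC (measurableSet_sizeEv n),
      Pr_setEdges_split hp heG.1 heG.2 (measurableSet_sizeEv n)]
    have hmono : (A ×ˢ (Finset.univ : Finset ι)) ⊆ (insert b A) ×ˢ (Finset.univ : Finset ι) :=
      Finset.product_subset_product_left (Finset.subset_insert _ _)
    refine add_le_add (mul_le_mul_of_nonneg_left (ih (insert b A) _ _ _ _
      (Finset.mem_insert_of_mem hA1) ?_ ?_ ?_ ?_ (hC.trans (Finset.union_subset_union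
        (Finset.image_subset_image hmono) (Finset.image_subset_image hmono))) ?_) hp.1)
      (mul_le_mul_of_nonneg_left (ih A _ _ _ _ hA1 hinj ?_ ?_ hO ?_ ?_) (sub_nonneg.2 hp.2))
    · rw [Finset.coe_insert, Set.injOn_insert (by simpa using hb)]
      exact ⟨hinj, by simpa using hFb⟩
    · intro ω hω x hx
      have hω' := fun e he => hω e (Finset.mem_insert_of_mem he)
      have heω := hω e (Finset.mem_insert_self _ _)
      rcases Finset.mem_insert.1 hx with rfl | hx
      · refine (hconn ω hω' a ha).tail ⟨e.2, ?_⟩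
        rcases he with ⟨h1, h2⟩ | ⟨h1, h2⟩
        · exact Or.inl ⟨h1 ▸ heω, h2⟩
        · exact Or.inr ⟨h1 ▸ heω, h2⟩
      · exact hconn ω hω' x hx
    · intro e' he'
      rw [Finset.insert_union, Finset.mem_insert] at he'
      rw [Finset.insert_union, Finset.mem_insert]
      exact he'.imp (fun h => by rw [h]) (hG e')
    · intro e' he'
      rcases Finset.mem_insert.1 he' with rfl | he'
      · rcases he with ⟨h1, h2⟩ | ⟨h1, h2⟩
        · exact ⟨by simpa only [h1] using ha1, by simpa only [h1, h2, map_mul] using hb1⟩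
        · exact ⟨by simpa only [h1] using hb1, by simpa only [h1, h2, map_mul] using ha1⟩
      · have := hO e' he'
        have hs : A.image F ⊆ (insert b A).image F :=
          Finset.image_subset_image (Finset.subset_insert _ _)
        exact ⟨hs this.1, hs this.2⟩
    · rw [Finset.card_insert_of_notMem hb]; omega
    · exact hconn
    · intro e' he'
      rw [Finset.union_insert, Finset.mem_insert] at he'
      rw [Finset.union_insert, Finset.mem_insert]
      exact he'.imp (fun h => by rw [h]) (hG e')
    · exact Finset.insert_subset heT hC
    · rw [Finset.card_insert_of_notMem heC]; omega

/-- The cluster of the identity in a quotient is stochastically smaller. -/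
lemma Pr_sizeEv_map_le (f : ι → G) (F : G →* H) {p : ℝ} (hp : p ∈ Set.Icc (0 : ℝ) 1) (n : ℕ) :
    Pr p (sizeEv (fun s => F (f s)) n) ≤ Pr p (sizeEv f n) := by
  classical
  have h := Pr_sizeEv_explore f F hp n (n * (1 + 2 * Fintype.card ι)) {1} ∅ ∅ ∅ ∅ (by simp)
    (by simp) (fun ω _ x hx => by
      rw [Finset.mem_singleton.1 hx]; exact Relation.ReflTransGen.refl) (by simp) (by simp)
    (by simp) (by simp)
  simpa [setEdges_empty] using h

lemma theta_map_le (f : ι → G) (F : G →* H) {p : ℝ} (hp : p ∈ Set.Icc (0 : ℝ) 1) :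
    theta (fun s => F (f s)) (bern (H × ι) p) ≤ theta f (bern (G × ι) p) :=
  le_theta fun n => (theta_le_sizeEv p n).trans (Pr_sizeEv_map_le f F hp n)

/-- Relabelling the generators does not change the percolation function. -/
lemma theta_reindex {ι' : Type*} [Countable ι'] (e : ι ≃ ι') (f : ι → G) (f' : ι' → G)
    (hf : ∀ s, f' (e s) = f s) (p : ℝ) :
    theta f' (bern (G × ι') p) = theta f (bern (G × ι) p) := by
  have hstep : ∀ (ω : Config (G × ι')) (a b : G),
      Step f (ω ∘ Prod.map id e) a b ↔ Step f' ω a b := by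
    intro ω a b
    simp only [Step, e.surjective.exists, hf]
    rfl
  have hcl : ∀ ω : Config (G × ι'), cluster f' ω = cluster f (ω ∘ Prod.map id e) := by
    intro ω
    have : Step f (ω ∘ Prod.map id e) = Step f' ω := by
      ext a b; exact hstep ω a b
    simp only [cluster, Conn, this]
  have hm : MeasurableSet {ω : Config (G × ι) | (cluster f ω).Infinite} := by
    have : {ω : Config (G × ι) | (cluster f ω).Infinite} = ⋂ n, sizeEv f n := by
      ext ω; simp [cluster_infinite_iff]
    rw [this]
    exact MeasurableSet.iInter fun n => measurableSet_sizeEv n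
  rw [theta_eq_Pr, theta_eq_Pr, ← Pr_comp (T := Set.univ) (fun ω ω' h hω => by
    have : ω = ω' := funext fun e => h e (Set.mem_univ e)
    rwa [← this]) hm (g := Prod.map id e)
      (Function.Injective.prodMap Function.injective_id e.injective).injOn p]
  simp only [hcl]
  rfl

end Quotient

/-! ### Exponential decay in subcritical factors -/

/-- A bounded function satisfying an affine contractive self-bound obeys the fixed point bound. -/
lemma le_of_contraction {α : Type*} {P : α → Prop} {T : α → ℝ} {C κ M : ℝ} (hκ0 : 0 ≤ κ)
    (hκ : κ < 1) (hM : ∀ a, P a → T a ≤ M)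
    (h : ∀ X, (∀ a, P a → T a ≤ X) → ∀ a, P a → T a ≤ C + κ * X) {a : α} (ha : P a) :
    T a ≤ C / (1 - κ) := by
  have hne : 1 - κ ≠ 0 := by linarith
  have key : ∀ m : ℕ, ∀ a, P a → T a ≤ C / (1 - κ) + κ ^ m * (M - C / (1 - κ)) := by
    intro m
    induction m with
    | zero => intro a ha; simpa using hM a ha
    | succ m ih =>
      intro a ha
      refine (h _ ih a ha).trans (le_of_eq ?_)
      field_simp
      ring
  have hlim : Filter.Tendsto (fun m : ℕ => C / (1 - κ) + κ ^ m * (M - C / (1 - κ))) Filter.atTop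
      (nhds (C / (1 - κ) + 0 * (M - C / (1 - κ)))) :=
    ((tendsto_pow_atTop_nhds_zero_of_lt_one hκ0 hκ).mul_const _).const_add _
  rw [zero_mul, add_zero] at hlim
  exact ge_of_tendsto' hlim fun m => key m a ha

section Simon

variable {K ι : Type*} [Group K] {f : ι → K} {t : ι → Bool}

/-- The element `f s` or its inverse, according to a sign. -/
def signed (f : ι → K) (x : ι × Bool) : K := if x.2 then f x.1 else (f x.1)⁻¹

lemma Step.exists_signed {ω : Config (K × ι)} {i : Bool} {u : K} {V : Set K} {a b : K}
    (h : Step f (mask (copy f t i u V) ω) a b) :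
    ∃ x : ι × Bool, t x.1 = i ∧ b = a * signed f x := by
  obtain ⟨s, ⟨h1, h2⟩ | ⟨h1, h2⟩⟩ := h
  · exact ⟨(s, true), (mask_eq_true.1 h1).2.1, by simpa [signed] using h2⟩
  · exact ⟨(s, false), (mask_eq_true.1 h1).2.1, by simp [signed, h2]⟩

lemma Step.copy_of_mem {ω : Config (K × ι)} {i : Bool} {u : K} {V : Set K} {a b : K}
    (h : Step f (mask (copy f t i u Set.univ) ω) a b) (ha : u⁻¹ * a ∈ V) (hb : u⁻¹ * b ∈ V) :
    Step f (mask (copy f t i u V) ω) a b := by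
  obtain ⟨s, ⟨h1, h2⟩ | ⟨h1, h2⟩⟩ := h
  · rw [mask_eq_true] at h1
    exact ⟨s, Or.inl ⟨mask_eq_true.2 ⟨h1.1, h1.2.1, ha, h2 ▸ hb⟩, h2⟩⟩
  · rw [mask_eq_true] at h1
    exact ⟨s, Or.inr ⟨mask_eq_true.2 ⟨h1.1, h1.2.1, hb, h2 ▸ ha⟩, h2⟩⟩

/-- The edges with an endpoint in `B`. -/
def touching (f : ι → K) (B : Set K) : Set (K × ι) := {e | e.1 ∈ B ∨ e.1 * f e.2 ∈ B}

lemma Step.touching {ω : Config (K × ι)} {B : Set K} {a b : K} (h : Step f ω a b) (ha : a ∈ B) :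
    Step f (mask (touching f B) ω) a b := by
  obtain ⟨s, ⟨h1, h2⟩ | ⟨h1, h2⟩⟩ := h
  · exact ⟨s, Or.inl ⟨mask_eq_true.2 ⟨h1, Or.inl ha⟩, h2⟩⟩
  · exact ⟨s, Or.inr ⟨mask_eq_true.2 ⟨h1, Or.inr (h2 ▸ ha)⟩, h2⟩⟩

lemma Step.not_touching {ω : Config (K × ι)} {B : Set K} {a b : K} (h : Step f ω a b)
    (ha : a ∉ B) (hb : b ∉ B) : Step f (mask (Perc.touching f B)ᶜ ω) a b := by
  obtain ⟨s, ⟨h1, h2⟩ | ⟨h1, h2⟩⟩ := h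
  · exact ⟨s, Or.inl ⟨mask_eq_true.2 ⟨h1, fun h => h.elim ha (h2 ▸ hb)⟩, h2⟩⟩
  · exact ⟨s, Or.inr ⟨mask_eq_true.2 ⟨h1, fun h => h.elim hb (h2 ▸ ha)⟩, h2⟩⟩

/-- A path leaving `B` has a last step out of `B`. -/
lemma Conn.exists_exit {ω : Config (K × ι)} {B : Set K} {x y : K} (h : Conn f ω x y) (hx : x ∈ B)
    (hy : y ∉ B) : ∃ a b, a ∈ B ∧ b ∉ B ∧ Step f ω a b ∧ Conn f (mask (touching f B)ᶜ ω) b y := by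
  have key : (∃ a b, a ∈ B ∧ b ∉ B ∧ Step f ω a b ∧ Conn f (mask (touching f B)ᶜ ω) b y) ∨
      (x ∉ B ∧ Conn f (mask (touching f B)ᶜ ω) x y) := by
    clear hx
    induction h using Relation.ReflTransGen.head_induction_on with
    | refl => exact Or.inr ⟨hy, Relation.ReflTransGen.refl⟩
    | @head x z hxz _ ih =>
      rcases ih with h | ⟨h1, h2⟩
      · exact Or.inl h
      · by_cases hx : x ∈ B
        · exact Or.inl ⟨x, z, hx, h1, hxz, h2⟩
        · exact Or.inr ⟨hx, h2.head (hxz.not_touching hx h1)⟩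
  exact key.resolve_right fun h => h.1 hx

/-- The event that the cluster of the identity inside the edge set `T` is exactly `B`. -/
def clusterEq (f : ι → K) (T : Set (K × ι)) (B : Finset K) : Set (Config (K × ι)) :=
  {ω | ∀ y, y ∈ B ↔ Conn f (mask T ω) 1 y}

lemma measurableSet_clusterEq [Countable ι] [Countable K] (T : Set (K × ι)) (B : Finset K) :
    MeasurableSet (clusterEq f T B) := by
  have : clusterEq f T B = ⋂ y : K, {ω | y ∈ B ↔ ω ∈ conn f T 1 y} := by
    ext ω; simp [clusterEq, mem_conn]
  rw [this]
  refine MeasurableSet.iInter fun y => ?_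
  by_cases hy : y ∈ B
  · simpa [hy] using measurableSet_conn_mask T 1 y
  · have : {ω | y ∈ B ↔ ω ∈ conn f T 1 y} = (conn f T 1 y)ᶜ := by ext ω; simp [hy]
    exact this ▸ (measurableSet_conn_mask T 1 y).compl

lemma depOn_clusterEq (T : Set (K × ι)) (B : Finset K) :
    DepOn (touching f (B : Set K)) (clusterEq f T B) := by
  intro ω ω' h hω
  have hm : ∀ (ω ω' : Config (K × ι)), (∀ e ∈ touching f (B : Set K), ω e = ω' e) → ∀ e,
      mask (touching f (B : Set K)) (mask T ω) e = true → mask T ω' e = true := by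
    intro ω ω' h e he
    rw [mask_eq_true, mask_eq_true] at he
    exact mask_eq_true.2 ⟨by rw [← h e he.2]; exact he.1.1, he.1.2⟩
  have h1 : ∀ y, Conn f (mask T ω) 1 y → Conn f (mask T ω') 1 y := by
    intro y hy
    induction hy with
    | refl => exact Relation.ReflTransGen.refl
    | @tail a b ha hab ih => exact ih.tail ((hab.touching (by exact (hω a).2 ha)).mono (hm ω ω' h))
  have h2 : ∀ y, Conn f (mask T ω') 1 y → Conn f (mask T ω) 1 y := by
    intro y hy
    induction hy with
    | refl => exact Relation.ReflTransGen.refl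
    | @tail a b ha hab ih =>
      exact ih.tail ((hab.touching (by exact (hω a).2 ih)).mono
        (hm ω' ω fun e he => (h e he).symm))
  exact fun y => (hω y).trans ⟨h1 y, h2 y⟩

variable [Fintype ι] [Countable K] [DecidableEq K]

/-- The signed generators of type `i` along which one can leave `V` from `a`. -/
def exits (f : ι → K) (t : ι → Bool) (i : Bool) (V : Finset K) (a : K) : Finset (ι × Bool) :=
  Finset.univ.filter fun x => t x.1 = i ∧ a * signed f x ∉ V

/-- Simon's inequality. -/
lemma tau_le_simon (p : ℝ) (i : Bool) {V : Finset K} (hV : 1 ∈ V) (x : K) :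
    tau f t p i Set.univ x ≤ tau f t p i V x + ∑ a ∈ V, ∑ s ∈ exits f t i V a,
      tau f t p i V a * tau f t p i Set.univ ((a * signed f s)⁻¹ * x) := by
  classical
  set U := copy f t i 1 Set.univ
  set W := copy f t i 1 (V : Set K)
  have hWV : ∀ {ω a}, Conn f (mask W ω) 1 a → a ∈ V := fun h => by
    simpa using conn_copy_mem (u := 1) (by simpa using hV) h
  have hsub : conn f U 1 x ⊆ conn f W 1 x ∪ ⋃ a ∈ V, ⋃ s ∈ exits f t i V a,
      ⋃ B ∈ V.powerset.filter (a ∈ ·),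
        clusterEq f W B ∩ conn f (U ∩ (touching f (B : Set K))ᶜ) (a * signed f s) x := by
    intro ω hω
    by_cases hx : ω ∈ conn f W 1 x
    · exact Or.inl hx
    refine Or.inr ?_
    let B : Finset K := V.filter fun y => Conn f (mask W ω) 1 y
    have hB : ∀ y, y ∈ B ↔ Conn f (mask W ω) 1 y := fun y => by
      simp only [B, Finset.mem_filter]
      exact ⟨fun h => h.2, fun h => ⟨hWV h, h⟩⟩
    obtain ⟨a, b, ha, hb, hab, hby⟩ := Conn.exists_exit (B := (B : Set K)) hω
      ((hB 1).2 Relation.ReflTransGen.refl) fun h => hx ((hB x).1 h)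
    obtain ⟨s, hs, rfl⟩ := hab.exists_signed
    have haV : a ∈ V := hWV ((hB a).1 ha)
    have hbV : a * signed f s ∉ V := by
      intro hbV
      refine hb ((hB _).2 (((hB a).1 ha).tail (hab.copy_of_mem ?_ ?_)))
      · simpa using haV
      · simpa using hbV
    simp only [Set.mem_iUnion, exists_prop]
    refine ⟨a, haV, s, by simp [exits, hs, hbV], B, ?_, hB, ?_⟩
    · simp only [Finset.mem_filter, Finset.mem_powerset]
      exact ⟨Finset.filter_subset _ _, ha⟩
    · refine Conn.mono (fun e he => ?_) hby
      rw [mask_eq_true, mask_eq_true] at he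
      exact mask_eq_true.2 ⟨he.1.1, he.1.2, he.2⟩
  refine (Pr_mono p hsub).trans ((Pr_union_le p _ _).trans (add_le_add le_rfl ?_))
  refine (measureReal_biUnion_finset_le _ _).trans (Finset.sum_le_sum fun a _ => ?_)
  refine (measureReal_biUnion_finset_le _ _).trans (Finset.sum_le_sum fun s _ => ?_)
  refine (measureReal_biUnion_finset_le _ _).trans ?_
  have h1 : ∀ B ∈ V.powerset.filter (a ∈ ·), (bern (K × ι) p).real
      (clusterEq f W B ∩ conn f (U ∩ (touching f (B : Set K))ᶜ) (a * signed f s) x) ≤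
      Pr p (clusterEq f W B) * tau f t p i Set.univ ((a * signed f s)⁻¹ * x) := by
    intro B _
    refine (Pr_inter (S := touching f (B : Set K)) (T := U ∩ (touching f (B : Set K))ᶜ)
      (Set.disjoint_left.2 fun e h h' => h'.2 h) (measurableSet_clusterEq _ _)
      (measurableSet_conn_mask _ _ _) (depOn_clusterEq _ _) (depOn_conn _ _ _) p).le.trans ?_
    refine mul_le_mul_of_nonneg_left ?_ (Pr_nonneg _ _)
    rw [← Pr_conn_copy_univ]
    exact Pr_mono p (conn_mono Set.inter_subset_left _ _)
  refine (Finset.sum_le_sum h1).trans ?_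
  rw [← Finset.sum_mul]
  refine mul_le_mul_of_nonneg_right ?_ (tau_nonneg _ _ _ _)
  simp only [Pr]
  rw [← measureReal_biUnion_finset]
  · refine Pr_mono p fun ω hω => ?_
    simp only [Set.mem_iUnion, exists_prop, Finset.mem_filter] at hω
    obtain ⟨B, hB, h⟩ := hω
    exact (h a).1 hB.2
  · intro B _ B' _ hne
    refine Set.disjoint_left.2 fun ω h h' => hne ?_
    ext y
    exact (h y).trans (h' y).symm
  · exact fun B _ => measurableSet_clusterEq _ _

end Simon

section Decay

variable {K ι : Type*} [Group K] {f : ι → K} {t : ι → Bool} [Fintype ι] [Countable K]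
  [DecidableEq K]

/-- The balls around the identity with respect to the generators of type `i`. -/
def gball (f : ι → K) (t : ι → Bool) (i : Bool) : ℕ → Finset K
  | 0 => {1}
  | n + 1 => gball f t i n ∪
    (gball f t i n ×ˢ Finset.univ.filter fun x : ι × Bool => t x.1 = i).image
      fun y => y.1 * signed f y.2

omit [Countable K] in
lemma gball_subset_succ (i : Bool) (n : ℕ) : gball f t i n ⊆ gball f t i (n + 1) :=
  Finset.subset_union_left

omit [Countable K] in
lemma gball_mono (i : Bool) {m n : ℕ} (h : m ≤ n) : gball f t i m ⊆ gball f t i n :=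
  monotone_nat_of_le_succ (f := gball f t i) (gball_subset_succ i) h

omit [Countable K] in
lemma one_mem_gball (i : Bool) (n : ℕ) : 1 ∈ gball f t i n :=
  gball_mono i (Nat.zero_le n) (by simp [gball])

omit [Countable K] in
lemma mul_signed_mem_gball {i : Bool} {n : ℕ} {a : K} (ha : a ∈ gball f t i n) {x : ι × Bool}
    (hx : t x.1 = i) : a * signed f x ∈ gball f t i (n + 1) :=
  Finset.mem_union_right _ (Finset.mem_image.2 ⟨(a, x), by simp [ha, hx], rfl⟩)

omit [Countable K] in
lemma mul_mem_gball {i : Bool} {m n : ℕ} {a b : K} (ha : a ∈ gball f t i m)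
    (hb : b ∈ gball f t i n) : a * b ∈ gball f t i (m + n) := by
  induction n generalizing b with
  | zero =>
    obtain rfl : b = 1 := by simpa [gball] using hb
    simpa using ha
  | succ n ih =>
    rcases Finset.mem_union.1 hb with hb | hb
    · exact gball_subset_succ i _ (ih hb)
    · obtain ⟨⟨c, x⟩, hc, rfl⟩ := Finset.mem_image.1 hb
      simp only [Finset.mem_product, Finset.mem_filter, Finset.mem_univ, true_and] at hc
      rw [← mul_assoc]
      exact mul_signed_mem_gball (ih hc.1) hc.2

/-- The expected number of exits from the cluster of the identity within `V`. -/
noncomputable def phi (f : ι → K) (t : ι → Bool) (p : ℝ) (i : Bool) (V : Finset K) : ℝ :=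
  ∑ a ∈ V, ∑ _s ∈ exits f t i V a, tau f t p i V a

omit [Countable K] in
lemma phi_nonneg (p : ℝ) (i : Bool) (V : Finset K) : 0 ≤ phi f t p i V :=
  Finset.sum_nonneg fun _ _ => Finset.sum_nonneg fun _ _ => tau_nonneg _ _ _ _

lemma sum_tau_le_simon (p : ℝ) (i : Bool) {V : Finset K} (hV : 1 ∈ V) (Λ : Finset K) {X : ℝ}
    (hX : ∀ a ∈ V, ∀ s ∈ exits f t i V a,
      ∑ x ∈ Λ.image ((a * signed f s)⁻¹ * ·), tau f t p i Set.univ x ≤ X) :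
    ∑ x ∈ Λ, tau f t p i Set.univ x ≤ ∑ x ∈ Λ, tau f t p i V x + phi f t p i V * X := by
  refine (Finset.sum_le_sum fun x _ => tau_le_simon p i hV x).trans ?_
  rw [Finset.sum_add_distrib]
  refine add_le_add le_rfl ?_
  rw [Finset.sum_comm, phi, Finset.sum_mul]
  refine Finset.sum_le_sum fun a ha => ?_
  rw [Finset.sum_comm, Finset.sum_mul]
  refine Finset.sum_le_sum fun s hs => ?_
  rw [← Finset.mul_sum]
  refine mul_le_mul_of_nonneg_left ?_ (tau_nonneg _ _ _ _)
  refine le_trans (le_of_eq ?_) (hX a ha s hs)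
  rw [Finset.sum_image fun x _ y _ h => mul_left_cancel h]

lemma sum_tau_le_of_phi_le {p κ : ℝ} {i : Bool} {V : Finset K} (hV : 1 ∈ V) (hκ : κ < 1)
    (hφ : phi f t p i V ≤ κ) (Λ : Finset K) :
    ∑ x ∈ Λ, tau f t p i Set.univ x ≤ V.card / (1 - κ) := by
  have hκ0 : 0 ≤ κ := (phi_nonneg p i V).trans hφ
  refine le_of_contraction (α := Finset K) (P := fun Λ' => Λ'.card ≤ Λ.card)
    (T := fun Λ => ∑ x ∈ Λ, tau f t p i Set.univ x) (M := Λ.card) hκ0 hκ ?_ ?_ le_rfl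
  · intro Λ' h
    refine (Finset.sum_le_card_nsmul _ _ 1 fun x _ => tau_le_one _ _ _ _).trans ?_
    simpa using h
  · intro X hX Λ' h
    have hX0 : 0 ≤ X := by simpa using hX ∅ (by simp)
    refine (sum_tau_le_simon p i hV Λ' fun a _ s _ => hX _ (Finset.card_image_le.trans h)).trans ?_
    refine add_le_add ?_ (mul_le_mul_of_nonneg_right hφ hX0)
    have h1 : ∑ x ∈ Λ', tau f t p i V x ≤ ∑ x ∈ Λ' ∪ V, tau f t p i V x :=
      Finset.sum_le_sum_of_subset_of_nonneg Finset.subset_union_left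
        fun x _ _ => tau_nonneg _ _ _ _
    have h2 : ∑ x ∈ V, tau f t p i V x = ∑ x ∈ Λ' ∪ V, tau f t p i V x :=
      Finset.sum_subset Finset.subset_union_right
        fun x _ hx => tau_eq_zero (by simpa using hV) (by simpa using hx)
    refine (h1.trans h2.ge).trans ?_
    refine (Finset.sum_le_card_nsmul _ _ 1 fun x _ => tau_le_one _ _ _ _).trans ?_
    simp

lemma sum_tau_decay {p κ X : ℝ} {i : Bool} {n : ℕ} (hκ0 : 0 ≤ κ)
    (hφ : phi f t p i (gball f t i n) ≤ κ)
    (hX : ∀ Λ : Finset K, ∑ x ∈ Λ, tau f t p i Set.univ x ≤ X) (r : ℕ) (Λ : Finset K)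
    (hΛ : ∀ x ∈ Λ, x ∉ gball f t i (r * (n + 1))) :
    ∑ x ∈ Λ, tau f t p i Set.univ x ≤ κ ^ r * X := by
  have hX0 : 0 ≤ X := by simpa using hX ∅
  induction r generalizing Λ with
  | zero => simpa using hX Λ
  | succ r ih =>
    refine (sum_tau_le_simon p i (one_mem_gball (f := f) (t := t) i n) Λ
      (X := κ ^ r * X) ?_).trans ?_
    · intro a ha s hs
      refine ih _ fun y hy hy' => ?_
      obtain ⟨x, hx, rfl⟩ := Finset.mem_image.1 hy
      refine hΛ x hx ?_
      have := mul_mem_gball (mul_signed_mem_gball ha (Finset.mem_filter.1 hs).2.1) hy'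
      rw [mul_inv_cancel_left] at this
      exact gball_mono i (by ring_nf; omega) this
    · have h0 : ∑ x ∈ Λ, tau f t p i (gball f t i n) x = 0 :=
        Finset.sum_eq_zero fun x hx => tau_eq_zero
          (by simpa using one_mem_gball (f := f) (t := t) i n)
          fun h => hΛ x hx (gball_mono (f := f) (t := t) i (by nlinarith) (Finset.mem_coe.1 h))
      rw [h0, zero_add, pow_succ', mul_assoc]
      exact mul_le_mul_of_nonneg_right hφ (by positivity)

omit [Countable K] in
lemma phi_gball_le (p : ℝ) (i : Bool) (j : ℕ) :
    phi f t p i (gball f t i (j + 1)) ≤ (2 * Fintype.card ι : ℝ) *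
      ∑ a ∈ gball f t i (j + 1) \ gball f t i j, tau f t p i (gball f t i (j + 1)) a := by
  rw [phi, ← Finset.sum_sdiff (gball_subset_succ i j), Finset.sum_eq_zero
    (s := gball f t i j), add_zero, Finset.mul_sum]
  · refine Finset.sum_le_sum fun a _ => ?_
    rw [Finset.sum_const, nsmul_eq_mul]
    refine mul_le_mul_of_nonneg_right ?_ (tau_nonneg _ _ _ _)
    have : (exits f t i (gball f t i (j + 1)) a).card ≤ 2 * Fintype.card ι := by
      refine (Finset.card_filter_le _ _).trans (le_of_eq ?_)
      simp [Finset.card_univ, mul_comm]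
    exact_mod_cast this
  · intro a ha
    refine Finset.sum_eq_zero fun s hs => ?_
    have := (Finset.mem_filter.1 hs).2
    exact absurd (mul_signed_mem_gball ha this.1) this.2

omit [Countable K] in
lemma exists_phi_lt {p M : ℝ} {i : Bool}
    (hM : ∀ j, ∑ x ∈ gball f t i j, tau f t p i (gball f t i j) x ≤ M) :
    ∃ n, phi f t p i (gball f t i n) < 1 := by
  by_contra! hcon
  set D : ℝ := 2 * Fintype.card ι with hD
  have hD0 : 0 ≤ D := by positivity
  have key : ∀ L J : ℕ, J ≤ L → (J : ℝ) ≤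
      D * ∑ x ∈ gball f t i J, tau f t p i (gball f t i L) x := by
    intro L J
    induction J with
    | zero =>
      intro _
      simpa using mul_nonneg hD0 (Finset.sum_nonneg fun x _ => tau_nonneg (f := f) _ _ _ x)
    | succ J ih =>
      intro hJ
      rw [← Finset.sum_sdiff (gball_subset_succ i J), mul_add]
      have h1 := (hcon (J + 1)).trans (phi_gball_le p i J)
      have h2 := ih (by omega)
      have h3 : ∑ a ∈ gball f t i (J + 1) \ gball f t i J, tau f t p i (gball f t i (J + 1)) a ≤
          ∑ a ∈ gball f t i (J + 1) \ gball f t i J, tau f t p i (gball f t i L) a :=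
        Finset.sum_le_sum fun a _ => tau_mono_set _ _ (by exact_mod_cast gball_mono i hJ) _
      have h4 := mul_le_mul_of_nonneg_left h3 hD0
      push_cast
      linarith
  obtain ⟨L, hL⟩ := exists_nat_gt (D * M)
  have := (key L L le_rfl).trans (mul_le_mul_of_nonneg_left (hM L) hD0)
  linarith

lemma exists_phi_le (i : Bool) (V : Finset K) {p₀ : ℝ} (hp₀ : p₀ ∈ Set.Icc (0 : ℝ) 1)
    (h : phi f t p₀ i V < 1) :
    ∃ κ, 0 < κ ∧ κ < 1 ∧ ∃ δ > 0, ∀ p ∈ Set.Icc (0 : ℝ) 1, p ≤ p₀ + δ → phi f t p i V ≤ κ := by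
  obtain ⟨N, hN0, hN⟩ := tau_le_add (f := f) (t := t) i V.finite_toSet
  set Q : ℝ := ∑ a ∈ V, ∑ _s ∈ exits f t i V a, N with hQ
  have hQ0 : 0 ≤ Q := Finset.sum_nonneg fun _ _ => Finset.sum_nonneg fun _ _ => hN0
  have h0 := phi_nonneg (f := f) (t := t) p₀ i V
  refine ⟨(phi f t p₀ i V + 1) / 2, by linarith, by linarith,
    (1 - phi f t p₀ i V) / (2 * (Q + 1)), div_pos (by linarith) (by linarith), ?_⟩
  intro p hp hpδ
  rcases le_total p p₀ with hle | hle
  · have : phi f t p i V ≤ phi f t p₀ i V :=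
      Finset.sum_le_sum fun _ _ => Finset.sum_le_sum fun _ _ => tau_mono_param hle _ _ _
    linarith
  · have h1 : phi f t p i V ≤ phi f t p₀ i V + Q * (p - p₀) := by
      rw [hQ, Finset.sum_mul, phi, phi, ← Finset.sum_add_distrib]
      refine Finset.sum_le_sum fun a _ => ?_
      rw [Finset.sum_mul, ← Finset.sum_add_distrib]
      exact Finset.sum_le_sum fun _ _ => hN _ _ hp₀.1 hp.2 hle a
    have h2 : Q * (p - p₀) ≤ (1 - phi f t p₀ i V) / 2 := by
      have h3 : p - p₀ ≤ (1 - phi f t p₀ i V) / (2 * (Q + 1)) := by linarith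
      refine (mul_le_mul_of_nonneg_left h3 hQ0).trans ?_
      rw [mul_div_assoc', div_le_div_iff₀ (by linarith) (by norm_num)]
      nlinarith
    linarith

lemma exists_tail_bound {p₀ : ℝ} (hp₀ : p₀ ∈ Set.Icc (0 : ℝ) 1) {M : ℝ} {i : Bool}
    (hM : ∀ j, ∑ x ∈ gball f t i j, tau f t p₀ i (gball f t i j) x ≤ M) :
    ∃ δ > 0, ∃ X > 0, ∃ C > 0, ∃ γ > 0, ∀ p ∈ Set.Icc (0 : ℝ) 1, p ≤ p₀ + δ →
      (∀ Λ : Finset K, ∑ x ∈ Λ, tau f t p i Set.univ x ≤ X) ∧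
      ∀ j : ℕ, 1 ≤ j → ∀ Λ : Finset K, ∑ x ∈ Λ, tau f t p i Set.univ x ≤
        ∑ x ∈ Λ, tau f t p i (gball f t i j) x + C * Real.exp (-γ * j) := by
  obtain ⟨n, hn⟩ := exists_phi_lt hM
  obtain ⟨κ, hκ0, hκ1, δ, hδ, hφ⟩ := exists_phi_le i _ hp₀ hn
  set X : ℝ := (gball f t i n).card / (1 - κ) + 1 with hXdef
  have hX1 : (0 : ℝ) < X := by
    have : (0 : ℝ) ≤ (gball f t i n).card / (1 - κ) := div_nonneg (by positivity) (by linarith)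
    linarith
  have hlog : Real.log κ < 0 := Real.log_neg hκ0 hκ1
  refine ⟨δ, hδ, X, hX1, (2 * Fintype.card ι + 1) * (κ⁻¹ * X) * X, by positivity,
    -Real.log κ / (n + 1), div_pos (by linarith) (by positivity), fun p hp hpδ => ?_⟩
  have hX : ∀ Λ : Finset K, ∑ x ∈ Λ, tau f t p i Set.univ x ≤ X := fun Λ =>
    (sum_tau_le_of_phi_le (one_mem_gball i n) hκ1 (hφ p hp hpδ) Λ).trans (by linarith)
  refine ⟨hX, fun j hj Λ => ?_⟩
  obtain ⟨j, rfl⟩ : ∃ k, j = k + 1 := ⟨j - 1, by omega⟩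
  refine (sum_tau_le_simon p i (one_mem_gball (f := f) (t := t) i (j + 1)) Λ
    fun _ _ _ _ => hX _).trans ?_
  refine add_le_add le_rfl ?_
  have h1 : ∑ a ∈ gball f t i (j + 1) \ gball f t i j, tau f t p i (gball f t i (j + 1)) a ≤
      κ ^ (j / (n + 1)) * X := by
    refine (Finset.sum_le_sum fun a _ => tau_mono_set p i (Set.subset_univ _) a).trans
      (sum_tau_decay hκ0.le (hφ p hp hpδ) hX _ _ fun x hx hx' => ?_)
    exact (Finset.mem_sdiff.1 hx).2 (gball_mono (f := f) (t := t) i (Nat.div_mul_le_self _ _) hx')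
  have h2 : κ ^ (j / (n + 1)) ≤ κ⁻¹ * Real.exp (-(-Real.log κ / (n + 1)) * (j + 1 : ℕ)) := by
    rw [← Real.rpow_natCast, Real.rpow_def_of_pos hκ0, ← Real.exp_log (inv_pos.2 hκ0), Real.log_inv,
      ← Real.exp_add, Real.exp_le_exp]
    have h3 : ((j + 1 : ℕ) : ℝ) ≤ (n + 1) * (((j / (n + 1) : ℕ) : ℝ) + 1) := by
      have := Nat.lt_mul_div_succ j (Nat.succ_pos n)
      exact_mod_cast this
    have h4 : ((j + 1 : ℕ) : ℝ) / (n + 1) ≤ ((j / (n + 1) : ℕ) : ℝ) + 1 := by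
      rw [div_le_iff₀ (by positivity)]; linarith
    have h5 := mul_le_mul_of_nonpos_left h4 hlog.le
    have h6 : -(-Real.log κ / (n + 1)) * ((j + 1 : ℕ) : ℝ) =
        Real.log κ * (((j + 1 : ℕ) : ℝ) / (n + 1)) := by ring
    rw [h6]
    linarith
  have h7 : phi f t p i (gball f t i (j + 1)) ≤ (2 * Fintype.card ι + 1) *
      (κ⁻¹ * Real.exp (-(-Real.log κ / (n + 1)) * (j + 1 : ℕ)) * X) := by
    refine (phi_gball_le p i j).trans (mul_le_mul (by linarith) (h1.trans ?_) ?_ (by positivity))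
    · exact mul_le_mul_of_nonneg_right h2 hX1.le
    · exact Finset.sum_nonneg fun _ _ => tau_nonneg _ _ _ _
  refine (mul_le_mul_of_nonneg_right h7 hX1.le).trans (le_of_eq ?_)
  ring

end Decay

section SecondMoment

variable {E α : Type*}

lemma sum_sub_sum_le_Pr_iUnion (p : ℝ) (W : Finset α) {A : α → Set (Config E)}
    (hA : ∀ g ∈ W, MeasurableSet (A g)) (w : α → ℝ) :
    2 * ∑ g ∈ W, w g * Pr p (A g) - ∑ g ∈ W, ∑ h ∈ W, w g * w h * Pr p (A g ∩ A h) ≤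
      Pr p (⋃ g ∈ W, A g) := by
  have hU : MeasurableSet (⋃ g ∈ W, A g) := W.measurableSet_biUnion hA
  have hint_meas : ∀ B : Set (Config E), MeasurableSet B →
      Integrable (B.indicator (1 : Config E → ℝ)) (bern E p) := fun B hB =>
    (integrable_const (1 : ℝ)).indicator hB
  have hPr : ∀ B : Set (Config E), MeasurableSet B →
      Pr p B = ∫ ω, B.indicator (1 : Config E → ℝ) ω ∂(bern E p) := fun B hB =>
    (integral_indicator_one hB).symm
  have hi1 : ∀ g ∈ W, Integrable (fun ω => w g * (A g).indicator (1 : Config E → ℝ) ω)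
      (bern E p) := fun g hg => (hint_meas _ (hA g hg)).const_mul _
  have hi2 : ∀ g ∈ W, ∀ h ∈ W,
      Integrable (fun ω => w g * w h * (A g ∩ A h).indicator (1 : Config E → ℝ) ω)
      (bern E p) := fun g hg h hh => (hint_meas _ ((hA g hg).inter (hA h hh))).const_mul _
  have h1 : ∑ g ∈ W, w g * Pr p (A g) =
      ∫ ω, ∑ g ∈ W, w g * (A g).indicator (1 : Config E → ℝ) ω ∂(bern E p) := by
    rw [integral_finsetSum _ hi1]
    exact Finset.sum_congr rfl fun g hg => by rw [integral_const_mul, hPr _ (hA g hg)]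
  have h2 : ∑ g ∈ W, ∑ h ∈ W, w g * w h * Pr p (A g ∩ A h) =
      ∫ ω, ∑ g ∈ W, ∑ h ∈ W, w g * w h * (A g ∩ A h).indicator (1 : Config E → ℝ) ω
        ∂(bern E p) := by
    rw [integral_finsetSum _ fun g hg => integrable_finsetSum _ (hi2 g hg)]
    refine Finset.sum_congr rfl fun g hg => ?_
    rw [integral_finsetSum _ (hi2 g hg)]
    exact Finset.sum_congr rfl fun h hh => by
      rw [integral_const_mul, hPr _ ((hA g hg).inter (hA h hh))]
  rw [h1, h2, hPr _ hU, ← integral_const_mul, ← integral_sub]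
  · refine integral_mono ?_ (hint_meas _ hU) fun ω => ?_
    · exact ((integrable_finsetSum _ hi1).const_mul _).sub
        (integrable_finsetSum _ fun g hg => integrable_finsetSum _ (hi2 g hg))
    · have hsq : ∑ g ∈ W, ∑ h ∈ W, w g * w h * (A g ∩ A h).indicator (1 : Config E → ℝ) ω =
          (∑ g ∈ W, w g * (A g).indicator (1 : Config E → ℝ) ω) ^ 2 := by
        rw [sq, Finset.sum_mul_sum]
        refine Finset.sum_congr rfl fun g _ => Finset.sum_congr rfl fun h _ => ?_
        rw [Set.inter_indicator_one, Pi.mul_apply]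
        ring
      beta_reduce
      rw [hsq]
      by_cases hω : ω ∈ ⋃ g ∈ W, A g
      · rw [Set.indicator_of_mem hω, Pi.one_apply]
        nlinarith [sq_nonneg (∑ g ∈ W, w g * (A g).indicator (1 : Config E → ℝ) ω - 1)]
      · have : ∑ g ∈ W, w g * (A g).indicator (1 : Config E → ℝ) ω = 0 := by
          refine Finset.sum_eq_zero fun g hg => ?_
          rw [Set.indicator_of_notMem fun h => hω (Set.mem_biUnion hg h), mul_zero]
        rw [Set.indicator_of_notMem hω, this]
        simp
  · exact (integrable_finsetSum _ hi1).const_mul _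
  · exact integrable_finsetSum _ fun g hg => integrable_finsetSum _ (hi2 g hg)

/-- A second moment lower bound for the probability of a union of weakly correlated events. -/
lemma le_Pr_iUnion {p x M : ℝ} {W : Finset α} {A : α → Set (Config E)} {d s : α → ℝ}
    (hA : ∀ g ∈ W, MeasurableSet (A g)) (hx : 0 < x) (hM : (W.card : ℝ) ≤ M)
    (hd0 : ∀ g ∈ W, 0 ≤ d g) (hs : ∀ g ∈ W, x ≤ s g)
    (h1 : ∀ g ∈ W, Pr p (A g) = d g * s g)
    (h2 : ∀ g ∈ W, ∀ h ∈ W, g ≠ h → Pr p (A g ∩ A h) ≤ d g * s g * s h) :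
    (∑ g ∈ W, d g) * x / (1 + M * x) ≤ Pr p (⋃ g ∈ W, A g) := by
  classical
  have hM0 : 0 ≤ M := le_trans (by positivity) hM
  set m := ∑ g ∈ W, d g with hm
  have hm0 : 0 ≤ m := Finset.sum_nonneg hd0
  set l : ℝ := 1 / (1 + M * x) with hl
  have hl0 : 0 < l := by positivity
  refine le_trans ?_ (sum_sub_sum_le_Pr_iUnion p W hA fun g => l * (x / s g))
  have e1 : ∑ g ∈ W, l * (x / s g) * Pr p (A g) = l * (m * x) := by
    rw [hm, Finset.sum_mul, Finset.mul_sum]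
    refine Finset.sum_congr rfl fun g hg => ?_
    have := hx.trans_le (hs g hg)
    rw [h1 g hg]
    field_simp
  have e2 : ∀ g ∈ W, ∑ h ∈ W, l * (x / s g) * (l * (x / s h)) * Pr p (A g ∩ A h) ≤
      l ^ 2 * (d g * x + M * (d g * x ^ 2)) := by
    intro g hg
    have hsg := hx.trans_le (hs g hg)
    have hdg := hd0 g hg
    rw [← Finset.add_sum_erase _ _ hg]
    have a1 : l * (x / s g) * (l * (x / s g)) * Pr p (A g ∩ A g) ≤ l ^ 2 * (d g * x) := by
      rw [Set.inter_self, h1 g hg]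
      have : l * (x / s g) * (l * (x / s g)) * (d g * s g) = l ^ 2 * (d g * x) * (x / s g) := by
        field_simp
      rw [this]
      exact mul_le_of_le_one_right (by positivity) ((div_le_one hsg).2 (hs g hg))
    have a2 : ∑ h ∈ W.erase g, l * (x / s g) * (l * (x / s h)) * Pr p (A g ∩ A h) ≤
        M * (l ^ 2 * (d g * x ^ 2)) := by
      refine (Finset.sum_le_card_nsmul _ _ (l ^ 2 * (d g * x ^ 2)) fun h hh => ?_).trans ?_
      · obtain ⟨hne, hh⟩ := Finset.mem_erase.1 hh
        have hsh := hx.trans_le (hs h hh)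
        refine (mul_le_mul_of_nonneg_left (h2 g hg h hh hne.symm) (by positivity)).trans
          (le_of_eq ?_)
        field_simp
      · rw [nsmul_eq_mul]
        refine mul_le_mul_of_nonneg_right (le_trans ?_ hM) (by positivity)
        exact_mod_cast Finset.card_le_card (Finset.erase_subset _ _)
    nlinarith
  have e3 : ∑ g ∈ W, ∑ h ∈ W, l * (x / s g) * (l * (x / s h)) * Pr p (A g ∩ A h) ≤
      l ^ 2 * (m * x + M * (m * x ^ 2)) := by
    refine (Finset.sum_le_sum e2).trans (le_of_eq ?_)
    rw [← Finset.mul_sum, Finset.sum_add_distrib, ← Finset.mul_sum, ← Finset.sum_mul,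
      ← Finset.sum_mul]
  have e4 : l ^ 2 * (m * x + M * (m * x ^ 2)) = l * (m * x) := by
    rw [hl]; field_simp
  have e5 : m * x / (1 + M * x) = l * (m * x) := by rw [hl]; ring
  rw [e1, e5]
  linarith

end SecondMoment

/-! ### Free products -/

/-- The group `K` is the free product of the subgroups `A i`, and `ρ i y` is the first syllable of
the normal form of `y` if it lies in `A i`, and `1` otherwise. -/
structure IsFreeProd {K : Type*} [Group K] (A : Bool → Subgroup K) (ρ : Bool → K → K) : Prop where
  mem : ∀ i y, ρ i y ∈ A i
  mul : ∀ i, ∀ a ∈ A i, ∀ y, ρ i (a * y) = a * ρ i y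
  one : ∀ i, ρ i 1 = 1
  head : ∀ i y, ρ i y ≠ 1 → ρ (!i) y = 1
  induction : ∀ P : K → Prop, P 1 →
    (∀ i, ∀ a ∈ A i, a ≠ 1 → ∀ y, ρ i y = 1 → P y → P (a * y)) → ∀ y, P y

namespace IsFreeProd

variable {K : Type*} [Group K] {A : Bool → Subgroup K} {ρ : Bool → K → K}

lemma apply_mem (h : IsFreeProd A ρ) {i : Bool} {a : K} (ha : a ∈ A i) : ρ i a = a := by
  simpa [h.one] using h.mul i a ha 1

lemma head_not (h : IsFreeProd A ρ) {i : Bool} {y : K} (hy : ρ (!i) y ≠ 1) : ρ i y = 1 := by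
  simpa using h.head (!i) y hy

lemma apply_not (h : IsFreeProd A ρ) {i : Bool} {a : K} (ha : a ∈ A i) : ρ (!i) a = 1 := by
  by_cases h1 : a = 1
  · rw [h1, h.one]
  · exact h.head i a (by rwa [h.apply_mem ha])

lemma apply_mul_of_not (h : IsFreeProd A ρ) {i : Bool} {g y : K} (hg : g ∈ A i)
    (hy : ρ (!i) y ≠ 1) : ρ i (g * y) = g := by
  rw [h.mul i g hg, h.head_not hy, mul_one]

lemma eq_one (h : IsFreeProd A ρ) {y : K} (h1 : ∀ i, ρ i y = 1) : y = 1 := by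
  revert h1
  refine h.induction (fun y => (∀ i, ρ i y = 1) → y = 1) (fun _ => rfl) ?_ y
  intro i a ha ha1 y hy _ h1
  exact absurd (by simpa [h.mul i a ha, hy] using h1 i) ha1

/-- Right multiplication by an element of a factor does not change the first syllable, except
possibly if both elements lie in the corresponding factor. -/
lemma apply_mul_right (h : IsFreeProd A ρ) {i j : Bool} {s y : K} (hs : s ∈ A j)
    (hy : y ∉ A i ∨ i ≠ j) : ρ i (y * s) = ρ i y := by
  revert i j s
  refine h.induction (fun y => ∀ {i j : Bool} {s : K}, s ∈ A j → (y ∉ A i ∨ i ≠ j) →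
    ρ i (y * s) = ρ i y) ?_ ?_ y
  · intro i j s hs hy
    obtain rfl : i = !j := by
      rcases hy with hy | hy
      · exact absurd (A i).one_mem hy
      · revert hy; cases i <;> cases j <;> simp
    rw [one_mul, h.one, h.apply_not hs]
  · intro k a ha ha1 y hky ih i j s hs hy
    have hk : ρ k (a * y) = a := by rw [h.mul k a ha, hky, mul_one]
    rcases Bool.eq_or_eq_not i k with rfl | rfl
    · rw [mul_assoc, h.mul _ a ha, h.mul _ a ha]
      rw [ih hs (hy.imp_left fun hy hy' => hy ((A i).mul_mem ha hy'))]
    · rw [h.head k (a * y) (by rwa [hk])]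
      by_cases hyk : y ∈ A k ∧ k = j
      · obtain ⟨hyk, rfl⟩ := hyk
        exact h.apply_not ((A k).mul_mem ((A k).mul_mem ha hyk) hs)
      · refine h.head k _ ?_
        rw [mul_assoc, h.mul k a ha, ih hs (by tauto), hky, mul_one]
        exact ha1

end IsFreeProd

/-! ### Survival by comparison with a branching process -/

section Survival

variable {K ι : Type*} [Group K] {f : ι → K} {t : ι → Bool} {A : Bool → Subgroup K}
  {ρ : Bool → K → K}

/-- The edges which a branch of type `i` at `u` may use. -/
def branchEdges (t : ι → Bool) (ρ : Bool → K → K) (i : Bool) (u : K) : Set (K × ι) :=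
  {e | e.1 = u ∧ t e.2 = i ∨ ρ i (u⁻¹ * e.1) ≠ 1}

lemma copy_subset_branchEdges (h : IsFreeProd A ρ) {i : Bool} {V : Set K} (hV : V ⊆ A i) (u : K) :
    copy f t i u V ⊆ branchEdges t ρ i u := by
  rintro ⟨a, s⟩ ⟨h1, h2, -⟩
  by_cases ha : a = u
  · exact Or.inl ⟨ha, h1⟩
  · refine Or.inr ?_
    rw [h.apply_mem (hV h2)]
    exact fun h3 => ha (inv_mul_eq_one.1 h3).symm

lemma branchEdges_eq (h : IsFreeProd A ρ) {i : Bool} {u g : K} (hg : g ∈ A i)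
    {e : K × ι} (he : e ∈ branchEdges t ρ (!i) (u * g)) : ρ i (u⁻¹ * e.1) = g := by
  rcases he with ⟨he, -⟩ | he
  · rw [he, inv_mul_cancel_left, h.apply_mem hg]
  · have := h.apply_mul_of_not hg he
    rwa [mul_inv_rev, ← mul_assoc, ← mul_assoc, mul_inv_cancel, one_mul] at this

lemma branchEdges_subset (h : IsFreeProd A ρ) {i : Bool} {u g : K} (hg : g ∈ A i) (hg1 : g ≠ 1) :
    branchEdges t ρ (!i) (u * g) ⊆ branchEdges t ρ i u := fun _ he =>
  Or.inr (by rwa [branchEdges_eq h hg he])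

lemma disjoint_branchEdges (h : IsFreeProd A ρ) {i : Bool} {u g g' : K} (hg : g ∈ A i)
    (hg' : g' ∈ A i) (hne : g ≠ g') :
    Disjoint (branchEdges t ρ (!i) (u * g)) (branchEdges t ρ (!i) (u * g')) :=
  Set.disjoint_left.2 fun _ he he' =>
    hne ((branchEdges_eq h hg he).symm.trans (branchEdges_eq h hg' he'))

lemma disjoint_copy_branchEdges (h : IsFreeProd A ρ) {i : Bool} {V : Set K} (hV : V ⊆ A i)
    {u g : K} (hg : g ∈ A i) :
    Disjoint (copy f t i u V) (branchEdges t ρ (!i) (u * g)) := by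
  refine Set.disjoint_left.2 ?_
  rintro ⟨a, s⟩ ⟨h1, h2, -⟩ (⟨-, h3⟩ | h3)
  · simp [h1] at h3
  · refine h3 ?_
    have : (u * g)⁻¹ * a = g⁻¹ * (u⁻¹ * a) := by group
    exact this ▸ h.apply_not ((A i).mul_mem ((A i).inv_mem hg) (hV h2))

variable [DecidableEq K]

/-- The event that the exploration of the branch of type `i` at `u`, which passes through each
copy of a factor within the sets `V`, survives for `n` generations. -/
def branch (f : ι → K) (t : ι → Bool) (V : Bool → Finset K) :
    ℕ → Bool → K → Set (Config (K × ι))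
  | 0, _, _ => Set.univ
  | n + 1, i, u => ⋃ g ∈ (V i).erase 1, conn f (copy f t i u (V i)) u (u * g) ∩
      branch f t V n (!i) (u * g)

lemma measurableSet_branch [Countable ι] [Countable K] (V : Bool → Finset K) (n : ℕ) (i : Bool)
    (u : K) : MeasurableSet (branch f t V n i u) := by
  induction n generalizing i u with
  | zero => exact MeasurableSet.univ
  | succ n ih =>
    exact Finset.measurableSet_biUnion _ fun g _ =>
      (measurableSet_conn_mask _ _ _).inter (ih _ _)

lemma depOn_branch (h : IsFreeProd A ρ) {V : Bool → Finset K} (hV : ∀ i, (V i : Set K) ⊆ A i)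
    (n : ℕ) (i : Bool) (u : K) : DepOn (branchEdges t ρ i u) (branch f t V n i u) := by
  induction n generalizing i u with
  | zero => exact fun _ _ _ _ => trivial
  | succ n ih =>
    intro ω ω' hω hmem
    obtain ⟨g, hg, h1⟩ := Set.mem_iUnion₂.1 hmem
    obtain ⟨hg1, hgV⟩ := Finset.mem_erase.1 hg
    have hgA : g ∈ A i := hV i hgV
    exact Set.mem_iUnion₂.2 ⟨g, hg,
      ((depOn_conn _ _ _).mono (copy_subset_branchEdges h (hV i) u)).inter
        ((ih (!i) (u * g)).mono (branchEdges_subset h hgA hg1)) ω ω' (by simpa using hω) h1⟩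

lemma exists_of_mem_branch (h : IsFreeProd A ρ) {V : Bool → Finset K}
    (hV : ∀ i, (V i : Set K) ⊆ A i) {n : ℕ} {i : Bool} {u : K} {ω : Config (K × ι)}
    (hω : ω ∈ branch f t V n i u) :
    ∃ Λ : Finset K, Λ.card = n ∧ ∀ x ∈ Λ, Conn f ω u x ∧ ρ i (u⁻¹ * x) ≠ 1 := by
  induction n generalizing i u with
  | zero => exact ⟨∅, by simp⟩
  | succ n ih =>
    obtain ⟨g, hg, h1, h2⟩ := Set.mem_iUnion₂.1 hω
    obtain ⟨hg1, hgV⟩ := Finset.mem_erase.1 hg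
    have hgA : g ∈ A i := hV i hgV
    obtain ⟨Λ, hΛ, hx⟩ := ih h2
    have hc : Conn f ω u (u * g) := Conn.mono (fun _ he => (mask_eq_true.1 he).1) h1
    have hnot : u * g ∉ Λ := fun hmem => (hx _ hmem).2 (by simp [h.one])
    refine ⟨insert (u * g) Λ, by simp [hnot, hΛ], fun x hxm => ?_⟩
    rcases Finset.mem_insert.1 hxm with rfl | hxm
    · exact ⟨hc, by rwa [inv_mul_cancel_left, h.apply_mem hgA]⟩
    · refine ⟨hc.trans (hx x hxm).1, ?_⟩
      have h3 := h.apply_mul_of_not hgA (hx x hxm).2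
      rw [mul_inv_rev, ← mul_assoc, ← mul_assoc, mul_inv_cancel, one_mul] at h3
      rwa [h3]

lemma le_Pr_branch_succ [Countable ι] [Countable K] (h : IsFreeProd A ρ) {V : Bool → Finset K}
    (hV : ∀ i, (V i : Set K) ⊆ A i) {p x M : ℝ} {i : Bool} (hx : 0 < x)
    (hM : ((V i).card : ℝ) ≤ M) {n : ℕ} (ih : ∀ u, x ≤ Pr p (branch f t V n (!i) u)) (u : K) :
    (∑ g ∈ (V i).erase 1, tau f t p i (V i) g) * x / (1 + M * x) ≤
      Pr p (branch f t V (n + 1) i u) := by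
  have hA : ∀ g ∈ (V i).erase 1, g ∈ A i := fun g hg => hV i (Finset.mem_of_mem_erase hg)
  have hind : ∀ g ∈ (V i).erase 1, Pr p (conn f (copy f t i u (V i)) u (u * g) ∩
      branch f t V n (!i) (u * g)) = tau f t p i (V i) g * Pr p (branch f t V n (!i) (u * g)) := by
    intro g hg
    rw [Pr_inter (disjoint_copy_branchEdges h (hV i) (hA g hg)) (measurableSet_conn_mask _ _ _)
      (measurableSet_branch _ _ _ _) (depOn_conn _ _ _) (depOn_branch h hV _ _ _), Pr_conn_copy]
  refine le_Pr_iUnion (s := fun g => Pr p (branch f t V n (!i) (u * g))) (fun g _ =>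
    (measurableSet_conn_mask _ _ _).inter (measurableSet_branch _ _ _ _)) hx
    (le_trans (by exact_mod_cast Finset.card_le_card (Finset.erase_subset _ _)) hM)
    (fun g _ => tau_nonneg _ _ _ _) (fun g _ => ih _) hind ?_
  intro g hg g' hg' hne
  rw [← hind g hg, ← Pr_inter (S := copy f t i u (V i) ∪ branchEdges t ρ (!i) (u * g)) ?_
    ((measurableSet_conn_mask _ _ _).inter (measurableSet_branch _ _ _ _))
    (measurableSet_branch _ _ _ _) ((depOn_conn _ _ _).inter (depOn_branch h hV _ _ _))
    (depOn_branch h hV _ _ _)]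
  · exact Pr_mono p fun ω hω => ⟨hω.1, hω.2.2⟩
  · exact Disjoint.union_left (disjoint_copy_branchEdges h (hV i) (hA g' hg'))
      (disjoint_branchEdges h (hA g hg) (hA g' hg') hne)

/-- If the branching process exploring the finite sets `V i` in each copy of a factor is
supercritical, then there is percolation. -/
theorem theta_pos_of_one_lt [Countable ι] [Countable K] (h : IsFreeProd A ρ) {V : Bool → Finset K}
    (hV : ∀ i, (V i : Set K) ⊆ A i) {p : ℝ}
    (hm : 1 < (∑ g ∈ (V true).erase 1, tau f t p true (V true) g) *
      ∑ g ∈ (V false).erase 1, tau f t p false (V false) g) :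
    0 < theta f (bern (K × ι) p) := by
  set m : Bool → ℝ := fun i => ∑ g ∈ (V i).erase 1, tau f t p i (V i) g with hmdef
  have hm' : 1 < m true * m false := hm
  set M : ℝ := (V true).card + (V false).card with hMdef
  have hM : ∀ i, ((V i).card : ℝ) ≤ M := by
    intro i; cases i <;> simp [hMdef]
  have hm0 : ∀ i, 0 ≤ m i := fun i => Finset.sum_nonneg fun _ _ => tau_nonneg _ _ _ _
  have hM0 : 0 ≤ M := by positivity
  have hmM : ∀ i, m i ≤ M := by
    intro i
    refine (Finset.sum_le_card_nsmul _ _ 1 fun _ _ => tau_le_one _ _ _ _).trans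
      (le_trans ?_ (hM i))
    rw [nsmul_eq_mul, mul_one]
    exact_mod_cast Finset.card_le_card (Finset.erase_subset _ _)
  have hmt : 0 < m true := by
    rcases (hm0 true).lt_or_eq with h0 | h0
    · exact h0
    · rw [← h0, zero_mul] at hm'; linarith
  set D : ℝ := M * (1 + m true) + 1 with hD
  have hD0 : 0 < D := by have := mul_nonneg hM0 (add_nonneg zero_le_one (hm0 true)); linarith
  set ε : ℝ := min 1 ((m true * m false - 1) / D) with hε
  have hε0 : 0 < ε := lt_min one_pos (div_pos (by linarith) hD0)
  have hε1 : ε ≤ 1 := min_le_left _ _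
  have hεD : ε * D ≤ m true * m false - 1 := (le_div_iff₀ hD0).1 (min_le_right _ _)
  have hMε : 0 < 1 + M * ε := by positivity
  set x : Bool → ℝ := fun i => if i then m true * ε / (1 + M * ε) else ε with hx
  have hxf : x false = ε := rfl
  have hxt : x true = m true * ε / (1 + M * ε) := rfl
  have hx0 : ∀ i, 0 < x i := by
    intro i
    cases i
    · exact hε0
    · rw [hxt]; exact div_pos (mul_pos hmt hε0) hMε
  have hx1 : ∀ i, x i ≤ 1 := by
    intro i
    cases i
    · exact hε1
    · rw [hxt, div_le_one hMε]
      nlinarith [mul_le_mul_of_nonneg_right (hmM true) hε0.le]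
  have hstep : ∀ i, x i ≤ m i * x (!i) / (1 + M * x (!i)) := by
    intro i
    cases i
    · have h1 : 0 < 1 + M * x true := by nlinarith [mul_nonneg hM0 (hx0 true).le]
      change x false ≤ m false * x true / (1 + M * x true)
      rw [hxf, le_div_iff₀ h1, hxt]
      have h2 : ε * (1 + M * (m true * ε / (1 + M * ε))) =
          ε * (1 + M * ε + M * m true * ε) / (1 + M * ε) := by field_simp
      have h3 : m false * (m true * ε / (1 + M * ε)) = ε * (m true * m false) / (1 + M * ε) := by
        ring
      rw [h2, h3]
      refine div_le_div_of_nonneg_right (mul_le_mul_of_nonneg_left ?_ hε0.le) hMε.le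
      nlinarith
    · exact le_of_eq rfl
  have hbranch : ∀ n i u, x i ≤ Pr p (branch f t V n i u) := by
    intro n
    induction n with
    | zero => intro i u; simpa [branch, Pr] using hx1 i
    | succ n ih =>
      exact fun i u => (hstep i).trans (le_Pr_branch_succ h hV (hx0 _) (hM i) (ih (!i)) u)
  refine hε0.trans_le (le_theta fun n => (hbranch n false 1).trans (Pr_mono p fun ω hω => ?_))
  obtain ⟨Λ, h1, h2⟩ := exists_of_mem_branch h hV hω
  exact ⟨Λ, h1, fun y hy => (h2 y hy).1⟩

end Survival

/-! ### Extinction by exploring the cluster along the factors -/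

section Extinction

variable {K ι : Type*} [Group K] {f : ι → K} {t : ι → Bool} {A : Bool → Subgroup K}
  {ρ : Bool → K → K}

lemma IsFreeProd.apply_mul_gen (h : IsFreeProd A ρ) (hf : ∀ s, f s ∈ A (t s)) {i : Bool} {u a : K}
    {s : ι} (he : (a, s) ∉ copy f t i u (A i)) :
    ρ i (u⁻¹ * (a * f s)) = ρ i (u⁻¹ * a) := by
  rw [← mul_assoc]
  refine h.apply_mul_right (hf s) ?_
  by_contra hc
  push Not at hc
  refine he ⟨hc.2.symm, hc.1, ?_⟩
  simp only [← mul_assoc]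
  exact (A i).mul_mem hc.1 (hc.2 ▸ hf s)

/-- An open path which crosses a copy of a factor decomposes into an open path to the gate of the
copy and an open path within the copy. -/
lemma conn_subset_inter (h : IsFreeProd A ρ) (hf : ∀ s, f s ∈ A (t s)) {i : Bool} {u s : K}
    (hu : ρ i u⁻¹ = 1) (hs : s ∈ A i) (hs1 : s ≠ 1) {ω : Config (K × ι)}
    (hω : Conn f ω 1 (u * s)) :
    ω ∈ conn f (copy f t i u (A i))ᶜ 1 u ∩ conn f (copy f t i u (A i)) u (u * s) := by
  set T := copy f t i u (A i) with hT
  have key : ∀ y, Conn f ω 1 y → (ω ∈ conn f Tᶜ 1 y ∧ ρ i (u⁻¹ * y) = 1) ∨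
      (ω ∈ conn f Tᶜ 1 u ∧ ω ∈ conn f T u (u * ρ i (u⁻¹ * y))) := by
    intro y hy
    induction hy with
    | refl => exact Or.inl ⟨Relation.ReflTransGen.refl, by rwa [mul_one]⟩
    | @tail y z _ hyz ih =>
      have hcases : (Step f (mask T ω) y z ∧ u⁻¹ * y ∈ A i ∧ u⁻¹ * z ∈ A i) ∨
          (Step f (mask Tᶜ ω) y z ∧ ρ i (u⁻¹ * z) = ρ i (u⁻¹ * y)) := by
        obtain ⟨r, ⟨h1, rfl⟩ | ⟨h1, rfl⟩⟩ := hyz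
        · by_cases hr : (y, r) ∈ T
          · exact Or.inl ⟨⟨r, Or.inl ⟨mask_eq_true.2 ⟨h1, hr⟩, rfl⟩⟩, hr.2⟩
          · exact Or.inr ⟨⟨r, Or.inl ⟨mask_eq_true.2 ⟨h1, hr⟩, rfl⟩⟩, h.apply_mul_gen hf hr⟩
        · by_cases hr : (z, r) ∈ T
          · exact Or.inl ⟨⟨r, Or.inr ⟨mask_eq_true.2 ⟨h1, hr⟩, rfl⟩⟩, hr.2.2, hr.2.1⟩
          · exact Or.inr ⟨⟨r, Or.inr ⟨mask_eq_true.2 ⟨h1, hr⟩, rfl⟩⟩,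
              (h.apply_mul_gen hf hr).symm⟩
      rcases hcases with ⟨h1, h2, h3⟩ | ⟨h1, h2⟩
      · refine Or.inr ?_
        rw [h.apply_mem h3, mul_inv_cancel_left]
        rcases ih with ⟨ih1, ih2⟩ | ⟨ih1, ih2⟩
        · rw [h.apply_mem h2, inv_mul_eq_one] at ih2
          subst ih2
          exact ⟨ih1, Relation.ReflTransGen.single h1⟩
        · rw [h.apply_mem h2, mul_inv_cancel_left] at ih2
          exact ⟨ih1, Relation.ReflTransGen.tail ih2 h1⟩
      · rw [h2]
        exact ih.imp_left fun ih => ⟨Relation.ReflTransGen.tail ih.1 h1, ih.2⟩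
  have hr : ρ i (u⁻¹ * (u * s)) = s := by rw [inv_mul_cancel_left, h.apply_mem hs]
  rcases key _ hω with ⟨-, h1⟩ | h1
  · exact absurd (hr.symm.trans h1) hs1
  · rwa [hr] at h1

variable [Countable ι] [Countable K]

lemma Pr_conn_mul_le (h : IsFreeProd A ρ) (hf : ∀ s, f s ∈ A (t s)) {i : Bool} {u s : K}
    (hu : ρ i u⁻¹ = 1) (hs : s ∈ A i) (hs1 : s ≠ 1) (p : ℝ) :
    Pr p (conn f Set.univ 1 (u * s)) ≤ Pr p (conn f Set.univ 1 u) * tau f t p i Set.univ s := by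
  have h1 : conn f Set.univ 1 (u * s) ⊆
      conn f (copy f t i u (A i))ᶜ 1 u ∩ conn f (copy f t i u (A i)) u (u * s) := by
    intro ω hω
    rw [mem_conn, mask_univ] at hω
    exact conn_subset_inter h hf hu hs hs1 hω
  refine (Pr_mono p h1).trans ?_
  rw [Pr_inter disjoint_compl_left (measurableSet_conn_mask _ _ _) (measurableSet_conn_mask _ _ _)
    (depOn_conn _ _ _) (depOn_conn _ _ _), Pr_conn_copy]
  exact mul_le_mul (Pr_mono p (conn_mono (Set.subset_univ _) _ _))
    (tau_mono_set p i (Set.subset_univ _) s) (tau_nonneg _ _ _ _) (Pr_nonneg _ _)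

variable [DecidableEq K]

lemma sum_Pr_conn_le (h : IsFreeProd A ρ) (hf : ∀ s, f s ∈ A (t s)) {p m X : ℝ} {i : Bool} {k : ℕ}
    (hm : ∀ Λ : Finset K, 1 ∉ Λ → ∑ x ∈ Λ, tau f t p i Set.univ x ≤ m)
    (hX : ∀ Λ : Finset K, Λ.card ≤ k →
      ∑ x ∈ Λ.filter (fun x => ρ (!i) x⁻¹ ≠ 1), Pr p (conn f Set.univ 1 x) ≤ X)
    {Λ : Finset K} (hΛ : Λ.card ≤ k) :
    ∑ x ∈ Λ.filter (fun x => ρ i x⁻¹ ≠ 1), Pr p (conn f Set.univ 1 x) ≤ m * (1 + X) := by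
  have hm0 : 0 ≤ m := by simpa using hm ∅ (by simp)
  set Λ' := Λ.filter (fun x => ρ i x⁻¹ ≠ 1) with hΛ'
  set U := Λ'.image fun x => x * ρ i x⁻¹ with hU
  set S := Λ'.image fun x => (ρ i x⁻¹)⁻¹ with hS
  have hinv : ∀ x, ρ i (x * ρ i x⁻¹)⁻¹ = 1 := fun x => by
    rw [mul_inv_rev, h.mul i _ ((A i).inv_mem (h.mem i _)), inv_mul_cancel]
  have h1 : ∑ x ∈ Λ', Pr p (conn f Set.univ 1 x) ≤
      ∑ x ∈ Λ', Pr p (conn f Set.univ 1 (x * ρ i x⁻¹)) * tau f t p i Set.univ (ρ i x⁻¹)⁻¹ := by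
    refine Finset.sum_le_sum fun x hx => ?_
    have := Pr_conn_mul_le h hf (u := x * ρ i x⁻¹) (s := (ρ i x⁻¹)⁻¹) (hinv x)
      ((A i).inv_mem (h.mem i _)) (inv_ne_one.2 (Finset.mem_filter.1 hx).2) p
    rwa [mul_inv_cancel_right] at this
  have h2 : ∑ x ∈ Λ', Pr p (conn f Set.univ 1 (x * ρ i x⁻¹)) * tau f t p i Set.univ (ρ i x⁻¹)⁻¹ ≤
      ∑ y ∈ U ×ˢ S, Pr p (conn f Set.univ 1 y.1) * tau f t p i Set.univ y.2 := by
    have hinj : Set.InjOn (fun x => (x * ρ i x⁻¹, (ρ i x⁻¹)⁻¹)) (Λ' : Set K) := by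
      intro x _ y _ hxy
      obtain ⟨e1, e2⟩ := Prod.mk.inj hxy
      rw [inv_inj.1 e2] at e1
      exact mul_right_cancel e1
    rw [← Finset.sum_image (f := fun y : K × K =>
      Pr p (conn f Set.univ 1 y.1) * tau f t p i Set.univ y.2) hinj]
    refine Finset.sum_le_sum_of_subset_of_nonneg (fun y hy => ?_) fun y _ _ =>
      mul_nonneg (Pr_nonneg _ _) (tau_nonneg _ _ _ _)
    obtain ⟨x, hx, rfl⟩ := Finset.mem_image.1 hy
    exact Finset.mem_product.2 ⟨Finset.mem_image_of_mem _ hx, Finset.mem_image_of_mem _ hx⟩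
  have h3 : ∑ y ∈ U ×ˢ S, Pr p (conn f Set.univ 1 y.1) * tau f t p i Set.univ y.2 =
      (∑ u ∈ U, Pr p (conn f Set.univ 1 u)) * ∑ s ∈ S, tau f t p i Set.univ s := by
    rw [Finset.sum_mul_sum, Finset.sum_product]
  have h4 : ∑ s ∈ S, tau f t p i Set.univ s ≤ m := by
    refine hm S fun h1 => ?_
    obtain ⟨x, hx, hx1⟩ := Finset.mem_image.1 h1
    exact (Finset.mem_filter.1 hx).2 (inv_eq_one.1 hx1)
  have hUk : U.card ≤ k :=
    Finset.card_image_le.trans ((Finset.card_le_card (Finset.filter_subset _ _)).trans hΛ)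
  have h5 : ∑ u ∈ U, Pr p (conn f Set.univ 1 u) ≤ 1 + X := by
    have hsub : U ⊆ insert 1 (U.filter fun x => ρ (!i) x⁻¹ ≠ 1) := by
      intro u hu
      by_cases h6 : ρ (!i) u⁻¹ = 1
      · obtain ⟨x, -, rfl⟩ := Finset.mem_image.1 hu
        refine Finset.mem_insert.2 (Or.inl (inv_eq_one.1 (h.eq_one fun j => ?_)))
        rcases Bool.eq_or_eq_not j i with rfl | rfl
        exacts [hinv x, h6]
      · exact Finset.mem_insert_of_mem (Finset.mem_filter.2 ⟨hu, h6⟩)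
    refine (Finset.sum_le_sum_of_subset_of_nonneg hsub fun _ _ _ => Pr_nonneg _ _).trans ?_
    rw [Finset.sum_insert (by simp [h.one])]
    exact add_le_add (Pr_le_one _ _) (hX U hUk)
  have h6 : 0 ≤ ∑ u ∈ U, Pr p (conn f Set.univ 1 u) := Finset.sum_nonneg fun _ _ => Pr_nonneg _ _
  calc _ ≤ (∑ u ∈ U, Pr p (conn f Set.univ 1 u)) * ∑ s ∈ S, tau f t p i Set.univ s :=
        (h1.trans h2).trans h3.le
    _ ≤ (1 + X) * m := mul_le_mul h5 h4 (Finset.sum_nonneg fun _ _ => tau_nonneg _ _ _ _)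
        (h6.trans h5)
    _ = _ := mul_comm _ _

/-- If the expected numbers of points reached within each factor have product less than one, then
there is no percolation. -/
theorem theta_eq_zero_of_lt_one (h : IsFreeProd A ρ) (hf : ∀ s, f s ∈ A (t s)) {p : ℝ}
    {m : Bool → ℝ}
    (hm : ∀ i, ∀ Λ : Finset K, 1 ∉ Λ → ∑ x ∈ Λ, tau f t p i Set.univ x ≤ m i)
    (hlt : m true * m false < 1) : theta f (bern (K × ι) p) = 0 := by
  have hm0 : ∀ i, 0 ≤ m i := fun i => by simpa using hm i ∅ (by simp)
  have hprod : ∀ i, m i * m (!i) = m true * m false := by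
    intro i; cases i <;> simp [mul_comm]
  have hbound : ∀ i, ∀ Λ : Finset K,
      ∑ x ∈ Λ.filter (fun x => ρ i x⁻¹ ≠ 1), Pr p (conn f Set.univ 1 x) ≤
        (m i * (1 + m (!i))) / (1 - m i * m (!i)) := by
    intro i Λ
    refine le_of_contraction (α := Finset K) (P := fun Λ' => Λ'.card ≤ Λ.card)
      (T := fun Λ => ∑ x ∈ Λ.filter (fun x => ρ i x⁻¹ ≠ 1), Pr p (conn f Set.univ 1 x))
      (M := Λ.card) (mul_nonneg (hm0 _) (hm0 _)) (by rwa [hprod]) ?_ ?_ le_rfl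
    · intro Λ' hΛ'
      refine (Finset.sum_le_card_nsmul _ _ 1 fun x _ => Pr_le_one _ _).trans ?_
      rw [nsmul_eq_mul, mul_one]
      exact_mod_cast (Finset.card_le_card (Finset.filter_subset _ _)).trans hΛ'
    · intro X hX Λ' hΛ'
      have h1 : ∀ Λ' : Finset K, Λ'.card ≤ Λ.card →
          ∑ x ∈ Λ'.filter (fun x => ρ (!i) x⁻¹ ≠ 1), Pr p (conn f Set.univ 1 x) ≤
            m (!i) * (1 + X) := fun Λ' hΛ' =>
        sum_Pr_conn_le h hf (hm (!i)) (by simpa using hX) hΛ'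
      refine (sum_Pr_conn_le h hf (hm i) h1 hΛ').trans (le_of_eq ?_)
      ring
  have htot : ∃ B : ℝ, ∀ Λ : Finset K, ∑ x ∈ Λ, Pr p (conn f Set.univ 1 x) ≤ B := by
    refine ⟨1 + ((m true * (1 + m (!true))) / (1 - m true * m (!true)) +
      (m false * (1 + m (!false))) / (1 - m false * m (!false))), fun Λ => ?_⟩
    have hsub : Λ ⊆ {1} ∪ (Λ.filter (fun x => ρ true x⁻¹ ≠ 1) ∪
        Λ.filter (fun x => ρ false x⁻¹ ≠ 1)) := by
      intro x hx
      by_cases h1 : ρ true x⁻¹ = 1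
      · by_cases h2 : ρ false x⁻¹ = 1
        · have : x = 1 := inv_eq_one.1 (h.eq_one fun j => by cases j <;> assumption)
          simp [this]
        · simp [hx, h2]
      · simp [hx, h1]
    have hun : ∀ B C : Finset K, ∑ x ∈ B ∪ C, Pr p (conn f Set.univ 1 x) ≤
        ∑ x ∈ B, Pr p (conn f Set.univ 1 x) + ∑ x ∈ C, Pr p (conn f Set.univ 1 x) := fun B C => by
      rw [← Finset.sum_union_inter]
      exact le_add_of_nonneg_right (Finset.sum_nonneg fun _ _ => Pr_nonneg _ _)
    refine (Finset.sum_le_sum_of_subset_of_nonneg hsub fun _ _ _ => Pr_nonneg _ _).trans ?_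
    refine (hun _ _).trans (add_le_add ?_ ((hun _ _).trans (add_le_add (hbound _ _) (hbound _ _))))
    rw [Finset.sum_singleton]
    exact Pr_le_one _ _
  obtain ⟨B, hB⟩ := htot
  have hsum : ∑' x, bern (K × ι) p (conn f Set.univ 1 x) ≠ ∞ := by
    rw [ENNReal.tsum_eq_iSup_sum]
    refine ne_top_of_le_ne_top (ENNReal.ofReal_ne_top (r := B)) (iSup_le fun Λ => ?_)
    refine le_trans (le_of_eq ?_) (ENNReal.ofReal_le_ofReal (hB Λ))
    rw [ENNReal.ofReal_sum_of_nonneg fun _ _ => Pr_nonneg _ _]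
    exact Finset.sum_congr rfl fun x _ => (ofReal_measureReal (measure_ne_top _ _)).symm
  have hfin := ae_finite_setOfPred_mem hsum
  rw [theta]
  have h0 : bern (K × ι) p {ω | (cluster f ω).Infinite} = 0 := by
    rw [← ae_iff.1 hfin]
    congr 1
    ext ω
    simp only [Set.mem_ofPred_eq, mem_conn, mask_univ]
    rfl
  rw [h0, ENNReal.toReal_zero]

end Extinction

section Coprod

variable (G H : Type*) [Group G] [Group H]

/-- The two factors of a free product, as subgroups. -/
def coprodFactor (b : Bool) : Subgroup (Monoid.Coprod G H) :=
  if b then (Monoid.Coprod.inl : G →* Monoid.Coprod G H).range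
  else (Monoid.Coprod.inr : H →* Monoid.Coprod G H).range

variable {G H}

lemma inl_mem_coprodFactor (g : G) : Monoid.Coprod.inl g ∈ coprodFactor G H true := ⟨g, rfl⟩

lemma inr_mem_coprodFactor (h : H) : Monoid.Coprod.inr h ∈ coprodFactor G H false := ⟨h, rfl⟩

variable (G H)

/-- The map from a binary free product to the free product of its two factors. -/
def coprodToWord : Monoid.Coprod G H →* Monoid.CoprodI fun b => coprodFactor G H b :=
  Monoid.Coprod.lift
    ((Monoid.CoprodI.of (i := true)).comp
      (Monoid.Coprod.inl.codRestrict (coprodFactor G H true) inl_mem_coprodFactor))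
    ((Monoid.CoprodI.of (i := false)).comp
      (Monoid.Coprod.inr.codRestrict (coprodFactor G H false) inr_mem_coprodFactor))

lemma coprodToWord_mem {b : Bool} {a : Monoid.Coprod G H} (ha : a ∈ coprodFactor G H b) :
    coprodToWord G H a = Monoid.CoprodI.of (M := fun b => coprodFactor G H b) (i := b) ⟨a, ha⟩ := by
  cases b
  all_goals
    obtain ⟨g, rfl⟩ := ha
    simp only [coprodToWord, Monoid.Coprod.lift_apply_inl, Monoid.Coprod.lift_apply_inr]
    rfl

lemma lift_coprodToWord (y : Monoid.Coprod G H) :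
    Monoid.CoprodI.lift (fun b => (coprodFactor G H b).subtype) (coprodToWord G H y) = y := by
  have : (Monoid.CoprodI.lift fun b => (coprodFactor G H b).subtype).comp (coprodToWord G H) =
      MonoidHom.id _ := by
    refine Monoid.Coprod.hom_ext ?_ ?_
    · ext g
      simp [coprodToWord_mem G H (inl_mem_coprodFactor g)]
    · ext g
      simp [coprodToWord_mem G H (inr_mem_coprodFactor g)]
  exact DFunLike.congr_fun this y

lemma coprodToWord_lift (y : Monoid.CoprodI fun b => coprodFactor G H b) :
    coprodToWord G H (Monoid.CoprodI.lift (fun b => (coprodFactor G H b).subtype) y) = y := by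
  have : (coprodToWord G H).comp (Monoid.CoprodI.lift fun b => (coprodFactor G H b).subtype) =
      MonoidHom.id _ := by
    refine Monoid.CoprodI.ext_hom _ _ fun b => ?_
    ext a
    simp [coprodToWord_mem G H a.2]
  exact DFunLike.congr_fun this y

/-- A binary free product is the free product of its two factors. -/
theorem exists_isFreeProd : ∃ ρ, IsFreeProd (coprodFactor G H) ρ := by
  classical
  let W : Monoid.Coprod G H → Monoid.CoprodI.Word fun b => coprodFactor G H b :=
    fun y => coprodToWord G H y • Monoid.CoprodI.Word.empty
  have hW : ∀ (i : Bool) (y : Monoid.Coprod G H), (W y).fstIdx ≠ some i →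
      (Monoid.CoprodI.Word.equivPair i (W y)).head = 1 := fun i y hy => by
    rw [Monoid.CoprodI.Word.equivPair_eq_of_fstIdx_ne hy]
  refine ⟨fun i y => (Monoid.CoprodI.Word.equivPair i (W y)).head, ?_, ?_, ?_, ?_, ?_⟩
  · exact fun i y => Subtype.property _
  · intro i a ha y
    have : W (a * y) =
        Monoid.CoprodI.of (M := fun b => coprodFactor G H b) (i := i) ⟨a, ha⟩ • W y := by
      simp only [W, map_mul, mul_smul, coprodToWord_mem G H ha]
    simp only [this, Monoid.CoprodI.Word.equivPair_smul_same, Subgroup.coe_mul]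
  · intro i
    have h1 : (W 1).fstIdx ≠ some i := by
      simp [W, Monoid.CoprodI.Word.fstIdx]
    simp only [hW i 1 h1, Subgroup.coe_one]
  · intro i y hy
    have h1 : (W y).fstIdx = some i := by
      by_contra h1
      exact hy (by simp only [hW i y h1, Subgroup.coe_one])
    simp only [hW (!i) y (by simp [h1]), Subgroup.coe_one]
  · intro P h1 hP y
    have key : ∀ w : Monoid.CoprodI.Word fun b => coprodFactor G H b,
        P (Monoid.CoprodI.lift (fun b => (coprodFactor G H b).subtype) w.prod) := by
      intro w
      induction w using Monoid.CoprodI.Word.consRecOn with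
      | empty => simpa using h1
      | cons i m w h2 h3 ih =>
        rw [Monoid.CoprodI.Word.prod_cons, map_mul, Monoid.CoprodI.lift_of]
        refine hP i m m.2 (by simpa using h3) _ ?_ ih
        have hw : W (Monoid.CoprodI.lift (fun b => (coprodFactor G H b).subtype) w.prod) = w := by
          simp only [W, coprodToWord_lift]
          exact Monoid.CoprodI.Word.equiv.apply_symm_apply w
        rw [hW i _ (by rwa [hw]), Subgroup.coe_one]
    have := key (Monoid.CoprodI.Word.equiv (coprodToWord G H y))
    rwa [show (Monoid.CoprodI.Word.equiv (coprodToWord G H y)).prod = coprodToWord G H y from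
      Monoid.CoprodI.Word.equiv.symm_apply_apply _, lift_coprodToWord] at this

end Coprod

section Rate

variable {K ι : Type*} [Group K] {f : ι → K} {t : ι → Bool} [Fintype ι] [DecidableEq K]

lemma gball_subset {A : Bool → Subgroup K} (hf : ∀ s, f s ∈ A (t s)) (i : Bool) (n : ℕ) :
    (gball f t i n : Set K) ⊆ A i := by
  induction n with
  | zero => simp [gball, (A i).one_mem]
  | succ n ih =>
    intro x hx
    rcases Finset.mem_union.1 (Finset.mem_coe.1 hx) with hx | hx
    · exact ih hx
    · obtain ⟨⟨a, s⟩, h, rfl⟩ := Finset.mem_image.1 hx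
      simp only [Finset.mem_product, Finset.mem_filter_univ] at h
      refine (A i).mul_mem (ih h.1) ?_
      obtain ⟨s, b⟩ := s
      have := hf s
      rw [show t s = i from h.2] at this
      cases b
      · simpa [signed] using this
      · simpa [signed] using this

/-- The edges incident to the identity. -/
def edgesAtOne (f : ι → K) [DecidableEq ι] : Finset (K × ι) :=
  (Finset.univ.image fun s => (1, s)) ∪ Finset.univ.image fun s => ((f s)⁻¹, s)

lemma Conn.exists_edgesAtOne [DecidableEq ι] {T : Set (K × ι)} {ω : Config (K × ι)} {x : K}
    (hx : x ≠ 1) (h : ω ∈ conn f T 1 x) : ∃ e ∈ edgesAtOne f, ω e = true := by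
  rcases Relation.ReflTransGen.cases_head h with h | ⟨y, ⟨s, h | h⟩, -⟩
  · exact absurd h.symm hx
  · exact ⟨(1, s), by simp [edgesAtOne], (mask_eq_true.1 h.1).1⟩
  · refine ⟨(y, s), ?_, (mask_eq_true.1 h.1).1⟩
    simp [edgesAtOne, eq_inv_of_mul_eq_one_left h.2.symm]

/-- The expected number of nontrivial elements of the `j`-ball of the factor `i` that are connected
to the identity inside this ball. -/
noncomputable def ballMean (f : ι → K) (t : ι → Bool) (p : ℝ) (i : Bool) (j : ℕ) : ℝ :=
  ∑ x ∈ (gball f t i j).erase 1, tau f t p i (gball f t i j) x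

lemma ballMean_nonneg (p : ℝ) (i : Bool) (j : ℕ) : 0 ≤ ballMean f t p i j :=
  Finset.sum_nonneg fun _ _ => tau_nonneg _ _ _ _

lemma sum_gball_le (p : ℝ) (i : Bool) (j : ℕ) :
    ∑ x ∈ gball f t i j, tau f t p i (gball f t i j) x ≤ 1 + ballMean f t p i j := by
  rw [← Finset.add_sum_erase _ _ (one_mem_gball i j), ballMean]
  gcongr
  exact tau_le_one _ _ _ _

omit [Fintype ι] [DecidableEq K] in
lemma Conn.of_open {T : Set (K × ι)} {ω : Config (K × ι)} {s : ι} (hT : (1, s) ∈ T)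
    (h : ω (1, s) = true) : ω ∈ conn f T 1 (f s) :=
  Relation.ReflTransGen.single ⟨s, Or.inl ⟨mask_eq_true.2 ⟨h, hT⟩, (one_mul _).symm⟩⟩

lemma le_ballMean {p : ℝ} (hp : p ∈ Set.Icc (0 : ℝ) 1) {s : ι} (hs : f s ≠ 1) {j : ℕ}
    (hj : 1 ≤ j) : p ≤ ballMean f t p (t s) j := by
  have hmem : f s ∈ gball f t (t s) j := by
    refine gball_mono _ hj ?_
    have := mul_signed_mem_gball (f := f) (t := t) (one_mem_gball (f := f) (t := t) (t s) 0)
      (x := (s, true)) rfl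
    simpa [signed] using this
  calc p = Pr p {ω : Config (K × ι) | ω (1, s) = true} := (Pr_open hp _).symm
    _ ≤ tau f t p (t s) (gball f t (t s) j) (f s) :=
        Pr_mono p fun ω hω => Conn.of_open
          (mem_copy.2 ⟨rfl, by simpa using one_mem_gball _ _, by simpa using hmem⟩) hω
    _ ≤ ballMean f t p (t s) j :=
        Finset.single_le_sum (f := fun x => tau f t p (t s) (gball f t (t s) j) x)
          (fun _ _ => tau_nonneg _ _ _ _) (Finset.mem_erase.2 ⟨hs, hmem⟩)

lemma tau_zero {i : Bool} {V : Set K} {x : K} (hx : x ≠ 1) : tau f t 0 i V x = 0 := by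
  classical
  refine le_antisymm ?_ (tau_nonneg _ _ _ _)
  calc tau f t 0 i V x ≤ Pr 0 (⋃ e ∈ edgesAtOne f, {ω : Config (K × ι) | ω e = true}) :=
        Pr_mono 0 fun ω hω => by simpa using Conn.exists_edgesAtOne hx hω
    _ ≤ ∑ e ∈ edgesAtOne f, Pr 0 {ω : Config (K × ι) | ω e = true} :=
        measureReal_biUnion_finset_le _ _
    _ = 0 := Finset.sum_eq_zero fun e _ => Pr_open (by simp) e

variable [Countable K]

lemma ballMean_le_add (i : Bool) (j : ℕ) :
    ∃ N : ℝ, 0 ≤ N ∧ ∀ p q : ℝ, 0 ≤ p → q ≤ 1 → p ≤ q →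
      ballMean f t q i j ≤ ballMean f t p i j + N * (q - p) := by
  obtain ⟨N, hN0, hN⟩ := tau_le_add (f := f) (t := t) i (gball f t i j).finite_toSet
  refine ⟨((gball f t i j).erase 1).card * N, by positivity, fun p q hp hq hpq => ?_⟩
  refine (Finset.sum_le_sum fun x _ => hN p q hp hq hpq x).trans ?_
  rw [Finset.sum_add_distrib, Finset.sum_const, nsmul_eq_mul, mul_assoc, ballMean]

variable {A : Bool → Subgroup K} {ρ : Bool → K → K}

lemma ballMean_mul_le_one (h : IsFreeProd A ρ) (hf : ∀ s, f s ∈ A (t s)) {p : ℝ}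
    (hθ : theta f (bern (K × ι) p) ≤ 0) (j : ℕ) :
    ballMean f t p true j * ballMean f t p false j ≤ 1 := by
  by_contra! hcon
  exact hθ.not_gt (theta_pos_of_one_lt h (V := fun i => gball f t i j)
    (fun i => gball_subset hf i j) hcon)

lemma ballMean_mul_le_one_of_forall_lt (h : IsFreeProd A ρ) (hf : ∀ s, f s ∈ A (t s)) {p₀ : ℝ}
    (hp₀ : 0 < p₀) (hp₁ : p₀ ≤ 1)
    (hθ : ∀ p ∈ Set.Ico 0 p₀, theta f (bern (K × ι) p) ≤ 0) (j : ℕ) :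
    ballMean f t p₀ true j * ballMean f t p₀ false j ≤ 1 := by
  by_contra! hcon
  obtain ⟨N, -, hN⟩ := ballMean_le_add (f := f) (t := t) true j
  obtain ⟨N', -, hN'⟩ := ballMean_le_add (f := f) (t := t) false j
  set a := ballMean f t p₀ true j
  set b := ballMean f t p₀ false j
  have ha0 : 0 ≤ a := ballMean_nonneg _ _ _
  have hlim : Filter.Tendsto (fun p => (a - N * (p₀ - p)) * (b - N' * (p₀ - p)))
      (nhdsWithin p₀ (Set.Iio p₀)) (nhds (a * b)) := by
    have : Continuous fun p => (a - N * (p₀ - p)) * (b - N' * (p₀ - p)) := by fun_prop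
    simpa using (this.tendsto p₀).mono_left nhdsWithin_le_nhds
  have hlim' : Filter.Tendsto (fun p => b - N' * (p₀ - p))
      (nhdsWithin p₀ (Set.Iio p₀)) (nhds b) := by
    have : Continuous fun p => b - N' * (p₀ - p) := by fun_prop
    simpa using (this.tendsto p₀).mono_left nhdsWithin_le_nhds
  have hb : 0 < b := by
    by_contra! hb
    nlinarith
  obtain ⟨p, h1, h2, h3⟩ := ((hlim.eventually (lt_mem_nhds hcon)).and
    ((hlim'.eventually (lt_mem_nhds hb)).and (Ioo_mem_nhdsLT hp₀))).exists
  have h4 := hN p p₀ h3.1.le hp₁ h3.2.le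
  have h5 := hN' p p₀ h3.1.le hp₁ h3.2.le
  have h6 := ballMean_mul_le_one h hf (hθ p ⟨h3.1.le, h3.2⟩) j
  refine h1.not_ge (le_trans ?_ h6)
  exact mul_le_mul (by linarith) (by linarith) h2.le (ballMean_nonneg _ _ _)

/-- At the critical point the expected numbers of vertices connected to the identity inside the
balls of a factor are bounded. -/
lemma exists_sum_gball_le (h : IsFreeProd A ρ) (hf : ∀ s, f s ∈ A (t s))
    (hgen : ∀ i, ∃ s, t s = i ∧ f s ≠ 1) {p₀ : ℝ} (hp₀ : p₀ ∈ Set.Icc (0 : ℝ) 1)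
    (hθ : ∀ p ∈ Set.Ico 0 p₀, theta f (bern (K × ι) p) ≤ 0) (i : Bool) :
    ∃ M : ℝ, ∀ j, ∑ x ∈ gball f t i j, tau f t p₀ i (gball f t i j) x ≤ M := by
  rcases hp₀.1.eq_or_lt with rfl | hpos
  · refine ⟨1, fun j => (sum_gball_le _ _ _).trans ?_⟩
    rw [ballMean, Finset.sum_eq_zero fun x hx => tau_zero (Finset.ne_of_mem_erase hx), add_zero]
  · refine ⟨1 + 1 / p₀, fun j => ?_⟩
    rcases Nat.eq_zero_or_pos j with rfl | hj
    · refine (sum_gball_le _ _ _).trans ?_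
      have : 0 < 1 / p₀ := by positivity
      simpa [ballMean, gball] using hp₀.1
    · refine (sum_gball_le _ _ _).trans ?_
      gcongr
      rw [le_div_iff₀ hpos]
      have hprod : ballMean f t p₀ i j * ballMean f t p₀ (!i) j ≤ 1 := by
        have := ballMean_mul_le_one_of_forall_lt h hf hpos hp₀.2 hθ j
        cases i
        · rwa [mul_comm] at this
        · exact this
      obtain ⟨s, hs, hs1⟩ := hgen (!i)
      have := le_ballMean (t := t) hp₀ hs1 hj
      rw [hs] at this
      exact (mul_le_mul_of_nonneg_left this (ballMean_nonneg _ _ _)).trans hprod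

/-- The expected number of nontrivial elements connected to the identity inside the factor `i`. -/
noncomputable def factorMean (f : ι → K) (t : ι → Bool) (p : ℝ) (i : Bool) : ℝ :=
  ⨆ Λ : Finset K, ∑ x ∈ Λ.erase 1, tau f t p i Set.univ x

/-- The expected cluster size in a factor grows at least linearly. -/
lemma factorMean_add_le {i : Bool} {s : ι} (hs : t s = i) (hs1 : f s ≠ 1) {X r : ℝ} (hr : r ≤ 1) :
    ∃ n : ℕ, ∀ p q : ℝ, 0 ≤ p → p ≤ q → q ≤ r →
      (∀ Λ : Finset K, ∑ x ∈ Λ, tau f t q i Set.univ x ≤ X) →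
      factorMean f t p i + (q - p) * (1 - r) ^ n ≤ factorMean f t q i := by
  classical
  refine ⟨((edgesAtOne f).erase (1, s)).card, fun p q hp hpq hqr hX => ?_⟩
  have hbdd : BddAbove (Set.range fun Λ : Finset K => ∑ x ∈ Λ.erase 1, tau f t q i Set.univ x) :=
    ⟨X, by rintro _ ⟨Λ, rfl⟩; exact hX _⟩
  rw [← le_sub_iff_add_le]
  refine ciSup_le fun Λ => ?_
  rw [le_sub_iff_add_le]
  refine le_trans ?_ (le_ciSup hbdd (insert (f s) Λ))
  have hmem : f s ∈ (insert (f s) Λ).erase 1 := Finset.mem_erase.2 ⟨hs1, Finset.mem_insert_self _ _⟩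
  have hgrow : tau f t p i Set.univ (f s) +
      (q - p) * (1 - q) ^ ((edgesAtOne f).erase (1, s)).card ≤ tau f t q i Set.univ (f s) := by
    refine Pr_add_le_of_incr (e := (1, s)) (measurableSet_conn_mask _ _ _) (incr_conn _ _ _) hp hpq
      (hqr.trans hr) (Finset.notMem_erase _ _)
      (fun ω hω => Conn.of_open (mem_copy.2 ⟨hs, trivial, trivial⟩) hω) fun ω hω hF hcon => ?_
    obtain ⟨e, he, hopen⟩ := Conn.exists_edgesAtOne hs1 hcon
    by_cases h1 : e = (1, s)
    · rw [h1, hω] at hopen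
      exact Bool.noConfusion hopen
    · rw [hF e (Finset.mem_erase.2 ⟨h1, he⟩)] at hopen
      exact Bool.noConfusion hopen
  have hpow : (q - p) * (1 - r) ^ ((edgesAtOne f).erase (1, s)).card ≤
      (q - p) * (1 - q) ^ ((edgesAtOne f).erase (1, s)).card :=
    mul_le_mul_of_nonneg_left (pow_le_pow_left₀ (by linarith) (by linarith) _) (by linarith)
  have hsub : ∑ x ∈ Λ.erase 1, tau f t p i Set.univ x ≤
      ∑ x ∈ (insert (f s) Λ).erase 1, tau f t p i Set.univ x :=
    Finset.sum_le_sum_of_subset_of_nonneg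
      (Finset.erase_subset_erase _ (Finset.subset_insert _ _)) fun _ _ _ => tau_nonneg _ _ _ _
  have hrest : ∑ x ∈ ((insert (f s) Λ).erase 1).erase (f s), tau f t p i Set.univ x ≤
      ∑ x ∈ ((insert (f s) Λ).erase 1).erase (f s), tau f t q i Set.univ x :=
    Finset.sum_le_sum fun x _ => tau_mono_param hpq i _ x
  rw [← Finset.add_sum_erase _ _ hmem] at hsub
  rw [← Finset.add_sum_erase _ _ hmem]
  linarith

lemma one_le_factorMean_mul (h : IsFreeProd A ρ) (hf : ∀ s, f s ∈ A (t s)) {p X : ℝ}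
    (hX : ∀ i, ∀ Λ : Finset K, ∑ x ∈ Λ, tau f t p i Set.univ x ≤ X)
    (hθ : 0 < theta f (bern (K × ι) p)) :
    1 ≤ factorMean f t p true * factorMean f t p false := by
  by_contra! hcon
  refine hθ.ne' (theta_eq_zero_of_lt_one h hf (fun i Λ hΛ => ?_) hcon)
  have := le_ciSup (f := fun Λ : Finset K => ∑ x ∈ Λ.erase 1, tau f t p i Set.univ x)
    ⟨X, by rintro _ ⟨Λ, rfl⟩; exact hX i _⟩ Λ
  rwa [Finset.erase_eq_of_notMem hΛ] at this

omit [Countable K] in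
lemma factorMean_le_ballMean_add {p ε : ℝ} {i : Bool} {j : ℕ}
    (hε : ∀ Λ : Finset K, ∑ x ∈ Λ, tau f t p i Set.univ x ≤
      ∑ x ∈ Λ, tau f t p i (gball f t i j) x + ε) :
    factorMean f t p i ≤ ballMean f t p i j + ε := by
  refine ciSup_le fun Λ => (hε _).trans ?_
  gcongr
  rw [ballMean, ← Finset.sum_filter_add_sum_filter_not (Λ.erase 1) (· ∈ gball f t i j),
    Finset.sum_eq_zero (s := Finset.filter (· ∉ gball f t i j) _), add_zero]
  · refine Finset.sum_le_sum_of_subset_of_nonneg (fun x hx => ?_) fun _ _ _ => tau_nonneg _ _ _ _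
    rw [Finset.mem_filter] at hx
    exact Finset.mem_erase.2 ⟨Finset.ne_of_mem_erase hx.1, hx.2⟩
  · intro x hx
    exact tau_eq_zero (one_mem_gball i j) (by simpa using (Finset.mem_filter.1 hx).2)

omit [Countable K] in
lemma ballMean_le_of_forall_sum_le {p X : ℝ} {i : Bool}
    (hX : ∀ Λ : Finset K, ∑ x ∈ Λ, tau f t p i Set.univ x ≤ X) (j : ℕ) :
    ballMean f t p i j ≤ X :=
  (Finset.sum_le_sum fun x _ => tau_mono_set p i (Set.subset_univ _) x).trans (hX _)

lemma one_lt_mul_of_perturbation {a b a' b' m n X ε η : ℝ} (hε : 0 < ε) (hη : 0 < η)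
    (hab : 1 ≤ a * b) (hb0 : 0 ≤ b) (ha : a ≤ X) (ha' : a + (4 * X ^ 2 * ε + η) / 2 ≤ a')
    (hb : b ≤ b') (hb' : b' ≤ X) (hm : m ≤ X) (hm0 : 0 ≤ m) (hma : a' ≤ m + ε)
    (hnb : b' ≤ n + ε) : 1 < m * n := by
  have hXb : 1 ≤ X * b := hab.trans (mul_le_mul_of_nonneg_right ha hb0)
  have hbpos : 0 < b := hb0.lt_of_ne (by rintro rfl; simp at hXb; linarith)
  have hX : 0 < X := by linarith
  have h1 : a' * b' ≤ m * n + 2 * X * ε := by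
    calc a' * b' ≤ (m + ε) * b' := mul_le_mul_of_nonneg_right hma (by linarith)
      _ = m * b' + ε * b' := by ring
      _ ≤ m * (n + ε) + ε * X := by gcongr
      _ ≤ m * n + 2 * X * ε := by nlinarith
  have h2 : (a + (4 * X ^ 2 * ε + η) / 2) * b ≤ a' * b' := by
    refine mul_le_mul ha' hb hb0 (le_trans ?_ ha')
    have : 0 < a := by
      by_contra! h0
      nlinarith
    positivity
  have h3 : X * ε ≤ X * b * (X * ε) := le_mul_of_one_le_left (by positivity) hXb
  have h4 : 0 < η * b := mul_pos hη hbpos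
  nlinarith

/-- The truncations to balls of radius `j` are supercritical already at distance of order
`e^{-γj}` from the critical point. -/
theorem exists_one_lt_ballMean_mul (h : IsFreeProd A ρ) (hf : ∀ s, f s ∈ A (t s))
    (hgen : ∀ i, ∃ s, t s = i ∧ f s ≠ 1) {p₀ : ℝ} (hp₀ : 0 ≤ p₀) (hp₁ : p₀ < 1)
    (hθ : ∀ p ∈ Set.Ico 0 p₀, theta f (bern (K × ι) p) ≤ 0)
    (hθ' : ∀ ε > 0, ∃ p ∈ Set.Ico p₀ (p₀ + ε), 0 < theta f (bern (K × ι) p)) :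
    ∃ δ > 0, ∃ c > 0, ∃ γ > 0, p₀ + δ ≤ 1 ∧ ∀ j : ℕ, 1 ≤ j → c * Real.exp (-γ * j) ≤ δ →
      1 < ballMean f t (p₀ + c * Real.exp (-γ * j)) true j *
        ballMean f t (p₀ + c * Real.exp (-γ * j)) false j := by
  have htail : ∀ i, ∃ δ > 0, ∃ X > 0, ∃ C > 0, ∃ γ > 0, ∀ p ∈ Set.Icc (0 : ℝ) 1, p ≤ p₀ + δ →
      (∀ Λ : Finset K, ∑ x ∈ Λ, tau f t p i Set.univ x ≤ X) ∧
      ∀ j : ℕ, 1 ≤ j → ∀ Λ : Finset K, ∑ x ∈ Λ, tau f t p i Set.univ x ≤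
        ∑ x ∈ Λ, tau f t p i (gball f t i j) x + C * Real.exp (-γ * j) := fun i =>
    exists_tail_bound ⟨hp₀, hp₁.le⟩
      (exists_sum_gball_le h hf hgen ⟨hp₀, hp₁.le⟩ hθ i).choose_spec
  choose δ' hδ' X' hX' C' hC' γ' hγ' htail using htail
  obtain ⟨δ, hδ, hδ1, hδi⟩ : ∃ δ > 0, δ ≤ (1 - p₀) / 2 ∧ ∀ i, δ ≤ δ' i :=
    ⟨min ((1 - p₀) / 2) (min (δ' true) (δ' false)),
      lt_min (by linarith) (lt_min (hδ' _) (hδ' _)), min_le_left _ _, fun i => by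
        cases i <;> simp⟩
  obtain ⟨X, hX, hXi⟩ : ∃ X > 0, ∀ i, X' i ≤ X :=
    ⟨max (X' true) (X' false), lt_max_of_lt_left (hX' _), fun i => by cases i <;> simp⟩
  obtain ⟨C, hC, hCi⟩ : ∃ C > 0, ∀ i, C' i ≤ C :=
    ⟨max (C' true) (C' false), lt_max_of_lt_left (hC' _), fun i => by cases i <;> simp⟩
  obtain ⟨γ, hγ, hγi⟩ : ∃ γ > 0, ∀ i, γ ≤ γ' i :=
    ⟨min (γ' true) (γ' false), lt_min (hγ' _) (hγ' _), fun i => by cases i <;> simp⟩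
  obtain ⟨s, hs, hs1⟩ := hgen true
  obtain ⟨n, hn⟩ := factorMean_add_le (X := X) hs hs1 (r := p₀ + δ) (by linarith)
  set η := (1 - (p₀ + δ)) ^ n with hη
  have hη0 : 0 < η := pow_pos (by linarith) n
  set c := 4 * X ^ 2 * C / η + 1 with hc
  have hc0 : 0 < c := by positivity
  refine ⟨δ, hδ, c, hc0, γ, hγ, by linarith, fun j hj hle => ?_⟩
  have he : 0 < Real.exp (-γ * j) := Real.exp_pos _
  set q := p₀ + c * Real.exp (-γ * j) with hq
  have hbound : ∀ i, ∀ p, 0 ≤ p → p ≤ p₀ + δ → ∀ Λ : Finset K,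
      ∑ x ∈ Λ, tau f t p i Set.univ x ≤ X := fun i p h0 h1 Λ =>
    ((htail i p ⟨h0, by linarith⟩ (by linarith [hδi i])).1 Λ).trans (hXi i)
  have hce : 0 < c * Real.exp (-γ * j) := mul_pos hc0 he
  obtain ⟨p, hp, hpθ⟩ := hθ' (c * Real.exp (-γ * j) / 2) (half_pos hce)
  have hp0 : 0 ≤ p := hp₀.trans hp.1
  have hpq : p ≤ q := by linarith [hp.2]
  have hq0 : 0 ≤ q := hp0.trans hpq
  have hball : ∀ i, factorMean f t q i ≤ ballMean f t q i j + C * Real.exp (-γ * j) := by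
    intro i
    refine factorMean_le_ballMean_add fun Λ =>
      ((htail i q ⟨hq0, by linarith⟩ (by linarith [hδi i])).2 j hj Λ).trans ?_
    have hexp : Real.exp (-γ' i * j) ≤ Real.exp (-γ * j) :=
      Real.exp_le_exp.2 (mul_le_mul_of_nonneg_right (neg_le_neg (hγi i)) j.cast_nonneg)
    have := mul_le_mul (hCi i) hexp (Real.exp_pos _).le hC.le
    linarith
  have hab := one_le_factorMean_mul h hf (fun i => hbound i p hp0 (by linarith)) hpθ
  have hgrow := hn p q hp0 hpq (by linarith) (hbound true q hq0 (by linarith))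
  have hbb : factorMean f t p false ≤ factorMean f t q false := by
    refine ciSup_mono ⟨X, ?_⟩ fun Λ => Finset.sum_le_sum fun x _ => tau_mono_param hpq _ _ x
    rintro _ ⟨Λ, rfl⟩
    exact hbound false q hq0 (by linarith) _
  have ha1 : factorMean f t p true ≤ X := ciSup_le fun Λ => hbound _ p hp0 (by linarith) _
  have hb1 : factorMean f t q false ≤ X := ciSup_le fun Λ => hbound _ q hq0 (by linarith) _
  have hm1 : ballMean f t q true j ≤ X :=
    ballMean_le_of_forall_sum_le (hbound true q hq0 (by linarith)) j
  have hb0 : 0 ≤ factorMean f t p false :=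
    Real.iSup_nonneg fun Λ => Finset.sum_nonneg fun _ _ => tau_nonneg _ _ _ _
  have hgrow' : factorMean f t p true + c * Real.exp (-γ * j) / 2 * η ≤ factorMean f t q true :=
    le_trans (by gcongr; linarith [hp.2]) hgrow
  refine one_lt_mul_of_perturbation (mul_pos hC he) (mul_pos hη0 he) hab hb0 ha1 ?_ hbb hb1 hm1
    (ballMean_nonneg _ _ _) (hball true) (hball false)
  refine (le_of_eq ?_).trans hgrow'
  rw [hc]
  field_simp

end Rate

/-! ### Critical probabilities -/

section Critical

variable {K ι : Type*} [Group K] {f : ι → K} {μ : ℝ → Measure (Config (K × ι))}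

lemma bddBelow_pc : BddBelow ({p | p ∈ Set.Icc (0 : ℝ) 1 ∧ 0 < theta f (μ p)} ∪ {1}) :=
  ⟨0, by rintro p (hp | rfl); exacts [hp.1.1, zero_le_one]⟩

lemma pc_nonneg : 0 ≤ pc f μ :=
  le_csInf ⟨1, Or.inr rfl⟩ (by rintro p (hp | rfl); exacts [hp.1.1, zero_le_one])

lemma pc_le_one : pc f μ ≤ 1 := csInf_le bddBelow_pc (Or.inr rfl)

lemma pc_le {p : ℝ} (hp : p ∈ Set.Icc (0 : ℝ) 1) (h : 0 < theta f (μ p)) : pc f μ ≤ p :=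
  csInf_le bddBelow_pc (Or.inl ⟨hp, h⟩)

lemma theta_nonpos_of_lt_pc {p : ℝ} (hp : p ∈ Set.Ico 0 (pc f μ)) : theta f (μ p) ≤ 0 := by
  by_contra! h
  exact hp.2.not_ge (pc_le ⟨hp.1, hp.2.le.trans pc_le_one⟩ h)

lemma exists_theta_pos_of_pc_lt (h1 : pc f μ < 1) {ε : ℝ} (hε : 0 < ε) :
    ∃ p ∈ Set.Ico (pc f μ) (pc f μ + ε), 0 < theta f (μ p) := by
  obtain ⟨p, hp, hlt⟩ := exists_lt_of_csInf_lt (s := {p | p ∈ Set.Icc (0 : ℝ) 1 ∧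
    0 < theta f (μ p)} ∪ {1}) ⟨1, Or.inr rfl⟩ (lt_min (lt_add_of_pos_right (pc f μ) hε) h1)
  rcases hp with hp | rfl
  · exact ⟨p, ⟨pc_le hp.1 hp.2, hlt.trans_le (min_le_left _ _)⟩, hp.2⟩
  · exact absurd (hlt.trans_le (min_le_right _ _)) (lt_irrefl _)

lemma pc_mono {K' ι' : Type*} [Group K'] {f' : ι' → K'} {μ' : ℝ → Measure (Config (K' × ι'))}
    (h : ∀ p ∈ Set.Icc (0 : ℝ) 1, theta f' (μ' p) ≤ theta f (μ p)) : pc f μ ≤ pc f' μ' := by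
  refine le_csInf ⟨1, Or.inr rfl⟩ ?_
  rintro p (hp | rfl)
  · exact pc_le hp.1 (hp.2.trans_le (h p hp.1))
  · exact pc_le_one

lemma pc_eq_of_isBernoulli (hμ : ∀ p ∈ Set.Icc (0 : ℝ) 1, IsBernoulli p (μ p)) :
    pc f μ = pc f (bern (K × ι)) := by
  have (p) (hp : p ∈ Set.Icc (0 : ℝ) 1) : μ p = bern (K × ι) p := (hμ p hp).eq_bern hp
  exact le_antisymm (pc_mono fun p hp => by rw [this p hp]) (pc_mono fun p hp => by rw [this p hp])

end Critical

/-! ### Approximation of free products -/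

lemma countable_of_closure_eq_top {G : Type*} [Group G] {S : Set G} (hS : S.Finite)
    (h : Subgroup.closure S = ⊤) : Countable G := by
  have := hS.countable.to_subtype
  have hsurj : Function.Surjective (FreeGroup.lift (Subtype.val : S → G)) := by
    rw [← MonoidHom.range_eq_top, FreeGroup.range_lift_eq_closure, Subtype.range_coe, h]
  exact hsurj.countable

instance countable_coprod (G H : Type*) [Group G] [Group H] [Countable G] [Countable H] :
    Countable (Monoid.Coprod G H) :=
  (Monoid.Coprod.mk_surjective (M := G) (N := H)).countable

lemma exists_mem_ne_one {G : Type*} [Group G] [Nontrivial G] {S : Set G}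
    (h : Subgroup.closure S = ⊤) : ∃ s ∈ S, s ≠ 1 := by
  by_contra! hS
  have : Subgroup.closure S ≤ ⊥ := (Subgroup.closure_le _).2 fun s hs => by simp [hS s hs]
  rw [h] at this
  exact top_ne_bot (le_bot_iff.1 this)

section Approximation

variable {G₁ G₂ : Type*} [Group G₁] [Group G₂] {S₁ : Set G₁} {S₂ : Set G₂}

lemma mul_mem_ball {G : Type*} [Group G] {S : Set G} {n : ℕ} {a x : G} (ha : a ∈ ball S n)
    (hx : x ∈ S ∨ x⁻¹ ∈ S) : a * x ∈ ball S (n + 1) := by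
  obtain ⟨l, hl, hlS, rfl⟩ := ha
  refine ⟨l ++ [x], by simpa using hl, fun y hy => ?_, by simp⟩
  rcases List.mem_append.1 hy with hy | hy
  · exact hlS y hy
  · rwa [List.mem_singleton.1 hy]

lemma ball_mono {G : Type*} [Group G] {S : Set G} {m n : ℕ} (h : m ≤ n) : ball S m ⊆ ball S n :=
  fun _ ⟨l, hl, h'⟩ => ⟨l, hl.trans h, h'⟩

lemma one_mem_ball {G : Type*} [Group G] {S : Set G} (n : ℕ) : (1 : G) ∈ ball S n :=
  ⟨[], by simp⟩

lemma subset_ball {G : Type*} [Group G] {S : Set G} {n : ℕ} (hn : 1 ≤ n) : S ⊆ ball S n :=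
  fun x hx => ball_mono hn (by simpa using mul_mem_ball (one_mem_ball 0) (Or.inl hx))

lemma coprodGens_mem_coprodFactor (s : S₁ ⊕ S₂) :
    coprodGens S₁ S₂ s ∈ coprodFactor G₁ G₂ s.isLeft := by
  cases s with
  | inl s => exact inl_mem_coprodFactor _
  | inr s => exact inr_mem_coprodFactor _

variable [Fintype S₁] [Fintype S₂] [DecidableEq (Monoid.Coprod G₁ G₂)]

lemma gball_coprodGens_true_subset (n : ℕ) :
    (gball (coprodGens S₁ S₂) Sum.isLeft true n : Set (Monoid.Coprod G₁ G₂)) ⊆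
      Monoid.Coprod.inl '' ball S₁ n := by
  induction n with
  | zero => simpa [gball] using ⟨1, one_mem_ball 0, map_one _⟩
  | succ n ih =>
    intro x hx
    rcases Finset.mem_union.1 (Finset.mem_coe.1 hx) with hx | hx
    · exact Set.image_mono (ball_mono n.le_succ) (ih hx)
    · obtain ⟨⟨a, s | s, b⟩, h, rfl⟩ := Finset.mem_image.1 hx
      · simp only [Finset.mem_product, Finset.mem_filter_univ] at h
        obtain ⟨a, ha, rfl⟩ := ih h.1
        cases b
        · exact ⟨a * (s : G₁)⁻¹, mul_mem_ball ha (Or.inr (by simp)), by simp [signed, coprodGens]⟩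
        · exact ⟨a * s, mul_mem_ball ha (Or.inl s.2), by simp [signed, coprodGens]⟩
      · simp at h

lemma gball_coprodGens_false_subset (n : ℕ) :
    (gball (coprodGens S₁ S₂) Sum.isLeft false n : Set (Monoid.Coprod G₁ G₂)) ⊆
      Monoid.Coprod.inr '' ball S₂ n := by
  induction n with
  | zero => simpa [gball] using ⟨1, one_mem_ball 0, map_one _⟩
  | succ n ih =>
    intro x hx
    rcases Finset.mem_union.1 (Finset.mem_coe.1 hx) with hx | hx
    · exact Set.image_mono (ball_mono n.le_succ) (ih hx)
    · obtain ⟨⟨a, s | s, b⟩, h, rfl⟩ := Finset.mem_image.1 hx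
      · simp at h
      · simp only [Finset.mem_product, Finset.mem_filter_univ] at h
        obtain ⟨a, ha, rfl⟩ := ih h.1
        cases b
        · exact ⟨a * (s : G₂)⁻¹, mul_mem_ball ha (Or.inr (by simp)), by simp [signed, coprodGens]⟩
        · exact ⟨a * s, mul_mem_ball ha (Or.inl s.2), by simp [signed, coprodGens]⟩

variable {H₁ H₂ : Type*} [Group H₁] [Group H₂] {φ₁ : G₁ →* H₁} {φ₂ : G₂ →* H₂} {j : ℕ}

lemma injOn_map_gball (h₁ : Set.InjOn φ₁ (ball S₁ j)) (h₂ : Set.InjOn φ₂ (ball S₂ j)) (i : Bool) :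
    Set.InjOn (Monoid.Coprod.map φ₁ φ₂)
      (gball (coprodGens S₁ S₂) Sum.isLeft i j : Set (Monoid.Coprod G₁ G₂)) := by
  intro x hx y hy hxy
  cases i
  · obtain ⟨a, ha, rfl⟩ := gball_coprodGens_false_subset j hx
    obtain ⟨b, hb, rfl⟩ := gball_coprodGens_false_subset j hy
    simp only [Monoid.Coprod.map_apply_inr] at hxy
    rw [h₂ ha hb (Monoid.Coprod.inr_injective hxy)]
  · obtain ⟨a, ha, rfl⟩ := gball_coprodGens_true_subset j hx
    obtain ⟨b, hb, rfl⟩ := gball_coprodGens_true_subset j hy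
    simp only [Monoid.Coprod.map_apply_inl] at hxy
    rw [h₁ ha hb (Monoid.Coprod.inl_injective hxy)]

omit [Fintype S₁] [Fintype S₂] [DecidableEq (Monoid.Coprod G₁ G₂)] in
/-- The bijection between the generators of a free product and the generators of a free product
of quotients. -/
lemma exists_equiv_coprodGens (h₁ : Set.InjOn φ₁ S₁) (h₂ : Set.InjOn φ₂ S₂) :
    ∃ e : S₁ ⊕ S₂ ≃ (φ₁ '' S₁) ⊕ (φ₂ '' S₂), (∀ s, (e s).isLeft = s.isLeft) ∧
      ∀ s, coprodGens (φ₁ '' S₁) (φ₂ '' S₂) (e s) =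
        Monoid.Coprod.map φ₁ φ₂ (coprodGens S₁ S₂ s) := by
  refine ⟨Equiv.sumCongr (Equiv.Set.imageOfInjOn φ₁ S₁ h₁) (Equiv.Set.imageOfInjOn φ₂ S₂ h₂),
    fun s => ?_, fun s => ?_⟩
  · cases s <;> rfl
  · cases s <;> rfl

variable [Countable G₁] [Countable G₂] [Countable H₁] [Countable H₂]

omit [DecidableEq (Monoid.Coprod G₁ G₂)] in
/-- The critical probability of a free product is at most that of a free product of quotients. -/
lemma pc_le_pc_map (h₁ : Set.InjOn φ₁ S₁) (h₂ : Set.InjOn φ₂ S₂) :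
    pc (coprodGens S₁ S₂) (bern _) ≤ pc (coprodGens (φ₁ '' S₁) (φ₂ '' S₂)) (bern _) := by
  obtain ⟨e, -, he⟩ := exists_equiv_coprodGens h₁ h₂
  have : Countable ((φ₁ '' S₁) ⊕ (φ₂ '' S₂)) := e.surjective.countable
  refine pc_mono fun p hp => ?_
  rw [theta_reindex e (fun s => Monoid.Coprod.map φ₁ φ₂ (coprodGens S₁ S₂ s)) _ he]
  exact theta_map_le _ _ hp

omit [Countable H₁] [Countable H₂] in
lemma ballMean_le_sum_map (h₁ : Set.InjOn φ₁ (ball S₁ j)) (h₂ : Set.InjOn φ₂ (ball S₂ j))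
    [DecidableEq (Monoid.Coprod H₁ H₂)] {ι : Type*} {f' : ι → Monoid.Coprod H₁ H₂}
    {t' : ι → Bool} {π : S₁ ⊕ S₂ → ι} (hπ : Function.Injective π)
    (ht : ∀ s, t' (π s) = s.isLeft)
    (hf' : ∀ s, f' (π s) = Monoid.Coprod.map φ₁ φ₂ (coprodGens S₁ S₂ s)) (p : ℝ) (i : Bool) :
    ballMean (coprodGens S₁ S₂) Sum.isLeft p i j ≤
      ∑ g ∈ ((gball (coprodGens S₁ S₂) Sum.isLeft i j).image (Monoid.Coprod.map φ₁ φ₂)).erase 1,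
        tau f' t' p i ((gball (coprodGens S₁ S₂) Sum.isLeft i j).image
          (Monoid.Coprod.map φ₁ φ₂)) g := by
  set F := Monoid.Coprod.map φ₁ φ₂ with hF
  set V := gball (coprodGens S₁ S₂) Sum.isLeft i j with hV
  have hinj : Set.InjOn F V := injOn_map_gball h₁ h₂ i
  have h1 : (1 : Monoid.Coprod G₁ G₂) ∈ V := one_mem_gball i j
  have himage : (V.erase 1).image F ⊆ (V.image F).erase 1 := by
    intro y hy
    obtain ⟨x, hx, rfl⟩ := Finset.mem_image.1 hy
    refine Finset.mem_erase.2 ⟨fun h => ?_, Finset.mem_image_of_mem F (Finset.mem_of_mem_erase hx)⟩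
    exact Finset.ne_of_mem_erase hx
      (hinj (Finset.mem_of_mem_erase hx) h1 (h.trans (map_one F).symm))
  refine le_trans ?_ (Finset.sum_le_sum_of_subset_of_nonneg himage fun _ _ _ => tau_nonneg _ _ _ _)
  rw [Finset.sum_image (hinj.mono (by simp)), ballMean]
  refine Finset.sum_le_sum fun x _ => ?_
  have := Pr_conn_le_of_map (f := coprodGens S₁ S₂) (f' := f') (F := F) (π := π)
    (T := copy (coprodGens S₁ S₂) Sum.isLeft i 1 V) (T' := copy f' t' i 1 (V.image F))
    (fun a s => by rw [map_mul, hf']) ?_ ?_ p 1 x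
  · rwa [map_one] at this
  · rintro ⟨a, s⟩ ha ⟨b, s'⟩ hb h
    simp only [Prod.map_apply, Prod.mk.injEq] at h
    rw [mem_copy] at ha hb
    simp only [inv_one, one_mul] at ha hb
    rw [hinj ha.2.1 hb.2.1 h.1, hπ h.2]
  · intro a s ha
    rw [mem_copy] at ha ⊢
    simp only [inv_one, one_mul] at ha ⊢
    rw [ht, hf', ← map_mul, Finset.coe_image]
    exact ⟨ha.1, Set.mem_image_of_mem F ha.2.1, Set.mem_image_of_mem F ha.2.2⟩

/-- If the percolation restricted to the balls of radius `j` is supercritical, then so is the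
percolation on a free product of quotients that are injective on these balls. -/
lemma pc_map_le (hj : 1 ≤ j) (h₁ : Set.InjOn φ₁ (ball S₁ j)) (h₂ : Set.InjOn φ₂ (ball S₂ j))
    {p : ℝ} (hp : p ∈ Set.Icc (0 : ℝ) 1)
    (h : 1 < ballMean (coprodGens S₁ S₂) Sum.isLeft p true j *
      ballMean (coprodGens S₁ S₂) Sum.isLeft p false j) :
    pc (coprodGens (φ₁ '' S₁) (φ₂ '' S₂)) (bern _) ≤ p := by
  classical
  obtain ⟨e, het, he⟩ := exists_equiv_coprodGens (h₁.mono (subset_ball hj))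
    (h₂.mono (subset_ball hj))
  have : Countable ((φ₁ '' S₁) ⊕ (φ₂ '' S₂)) := e.surjective.countable
  obtain ⟨ρ, hρ⟩ := exists_isFreeProd H₁ H₂
  have hle := ballMean_le_sum_map (t' := Sum.isLeft) h₁ h₂ e.injective het he p
  refine pc_le hp (theta_pos_of_one_lt (t := Sum.isLeft) hρ
    (V := fun i => (gball (coprodGens S₁ S₂) Sum.isLeft i j).image (Monoid.Coprod.map φ₁ φ₂))
    (fun i => ?_) (h.trans_le (mul_le_mul (hle true) (hle false) (ballMean_nonneg _ _ _)
      ((ballMean_nonneg _ _ _).trans (hle true)))))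
  intro y hy
  obtain ⟨x, hx, rfl⟩ := Finset.mem_image.1 (Finset.mem_coe.1 hy)
  cases i
  · obtain ⟨a, -, rfl⟩ := gball_coprodGens_false_subset j hx
    exact inr_mem_coprodFactor _
  · obtain ⟨a, -, rfl⟩ := gball_coprodGens_true_subset j hx
    exact inl_mem_coprodFactor _

end Approximation

lemma exists_nontrivial_coprodGens {G₁ G₂ : Type*} [Group G₁] [Group G₂] [Nontrivial G₁]
    [Nontrivial G₂] {S₁ : Set G₁} {S₂ : Set G₂} (hgen₁ : Subgroup.closure S₁ = ⊤)
    (hgen₂ : Subgroup.closure S₂ = ⊤) (i : Bool) :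
    ∃ s : S₁ ⊕ S₂, s.isLeft = i ∧ coprodGens S₁ S₂ s ≠ 1 := by
  cases i
  · obtain ⟨s, hs, h1⟩ := exists_mem_ne_one hgen₂
    exact ⟨Sum.inr ⟨s, hs⟩, rfl, fun h =>
      h1 (Monoid.Coprod.inr_injective (h.trans (map_one _).symm))⟩
  · obtain ⟨s, hs, h1⟩ := exists_mem_ne_one hgen₁
    exact ⟨Sum.inl ⟨s, hs⟩, rfl, fun h =>
      h1 (Monoid.Coprod.inl_injective (h.trans (map_one _).symm))⟩

end Perc

/-- If nontrivial finitely generated groups `G₁, G₂` are well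
approximated by quotients `Hᵢʲ` (the surjection `φᵢʲ : Gᵢ → Hᵢʲ` is injective on the
ball of radius `j`), then there are `c, γ > 0` with
`0 ≤ p_c(H₁ʲ * H₂ʲ) - p_c(G₁ * G₂) ≤ c·e^{-γj}` for all `j ≥ 1`; in particular
`p_c(H₁ʲ * H₂ʲ) → p_c(G₁ * G₂)`.  The Cayley graph of `H₁ʲ * H₂ʲ` is taken w.r.t.
`φ₁ʲ(S₁) ⊔ φ₂ʲ(S₂)`. -/
theorem pc_free_product_approximation
    {G₁ G₂ : Type*} [Group G₁] [Group G₂] [Nontrivial G₁] [Nontrivial G₂]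
    (S₁ : Set G₁) (S₂ : Set G₂) (hfin₁ : S₁.Finite) (hfin₂ : S₂.Finite)
    (hgen₁ : Subgroup.closure S₁ = ⊤) (hgen₂ : Subgroup.closure S₂ = ⊤)
    (H₁ H₂ : ℕ → Type*) [∀ j, Group (H₁ j)] [∀ j, Group (H₂ j)]
    (φ₁ : ∀ j, G₁ →* H₁ j) (φ₂ : ∀ j, G₂ →* H₂ j)
    (hsurj₁ : ∀ j, Function.Surjective (φ₁ j)) (hsurj₂ : ∀ j, Function.Surjective (φ₂ j))
    (hinj₁ : ∀ j, Set.InjOn (φ₁ j) (ball S₁ j)) (hinj₂ : ∀ j, Set.InjOn (φ₂ j) (ball S₂ j))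
    (μ : ℝ → Measure (Config (Monoid.Coprod G₁ G₂ × (S₁ ⊕ S₂))))
    (μH : ∀ j, ℝ → Measure (Config (Monoid.Coprod (H₁ j) (H₂ j) ×
      ((φ₁ j '' S₁) ⊕ (φ₂ j '' S₂)))))
    (hμ : ∀ p ∈ Set.Icc (0 : ℝ) 1, IsBernoulli p (μ p))
    (hμH : ∀ j, ∀ p ∈ Set.Icc (0 : ℝ) 1, IsBernoulli p (μH j p)) :
    ∃ c > (0 : ℝ), ∃ γ > (0 : ℝ),
      (∀ j : ℕ, 1 ≤ j →
        0 ≤ pc (coprodGens (φ₁ j '' S₁) (φ₂ j '' S₂)) (μH j) - pc (coprodGens S₁ S₂) μ ∧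
        pc (coprodGens (φ₁ j '' S₁) (φ₂ j '' S₂)) (μH j) - pc (coprodGens S₁ S₂) μ
          ≤ c * Real.exp (-γ * (j : ℝ))) ∧
      Filter.Tendsto (fun j : ℕ => pc (coprodGens (φ₁ j '' S₁) (φ₂ j '' S₂)) (μH j))
        Filter.atTop (nhds (pc (coprodGens S₁ S₂) μ)) := by
  have := hfin₁.fintype
  have := hfin₂.fintype
  have := countable_of_closure_eq_top hfin₁ hgen₁
  have := countable_of_closure_eq_top hfin₂ hgen₂
  have := fun j => (hsurj₁ j).countable
  have := fun j => (hsurj₂ j).countable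
  classical
  rw [pc_eq_of_isBernoulli hμ]
  simp only [fun j => pc_eq_of_isBernoulli (f := coprodGens (φ₁ j '' S₁) (φ₂ j '' S₂)) (hμH j)]
  set p₀ := pc (coprodGens S₁ S₂) (bern _) with hp₀
  set pH : ℕ → ℝ := fun j => pc (coprodGens (φ₁ j '' S₁) (φ₂ j '' S₂)) (bern _) with hpH
  have hmono (j : ℕ) (hj : 1 ≤ j) : p₀ ≤ pH j :=
    pc_le_pc_map ((hinj₁ j).mono (subset_ball hj)) ((hinj₂ j).mono (subset_ball hj))
  have key : ∃ c > (0 : ℝ), ∃ γ > (0 : ℝ), ∀ j : ℕ, 1 ≤ j →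
      pH j - p₀ ≤ c * Real.exp (-γ * j) := by
    rcases (pc_le_one : p₀ ≤ 1).eq_or_lt with h1 | h1
    · refine ⟨1, one_pos, 1, one_pos, fun j _ => ?_⟩
      have : pH j ≤ 1 := pc_le_one
      have := Real.exp_pos (-1 * (j : ℝ))
      linarith
    · obtain ⟨ρ, hρ⟩ := exists_isFreeProd G₁ G₂
      obtain ⟨δ, hδ, c, hc, γ, hγ, hδ1, hrate⟩ := exists_one_lt_ballMean_mul hρ
        coprodGens_mem_coprodFactor (exists_nontrivial_coprodGens hgen₁ hgen₂) pc_nonneg h1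
        (fun p hp => theta_nonpos_of_lt_pc hp) (fun ε hε => exists_theta_pos_of_pc_lt h1 hε)
      refine ⟨max c (c / δ), lt_max_of_lt_left hc, γ, hγ, fun j hj => ?_⟩
      have he : 0 < Real.exp (-γ * j) := Real.exp_pos _
      by_cases hle : c * Real.exp (-γ * j) ≤ δ
      · have hq : p₀ + c * Real.exp (-γ * j) ∈ Set.Icc (0 : ℝ) 1 :=
          ⟨add_nonneg pc_nonneg (mul_pos hc he).le, by linarith⟩
        have hpH_le : pH j ≤ p₀ + c * Real.exp (-γ * j) :=
          pc_map_le hj (hinj₁ j) (hinj₂ j) hq (hrate j hj hle)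
        have := mul_le_mul_of_nonneg_right (le_max_left c (c / δ)) he.le
        linarith
      · have h2 : 1 ≤ c / δ * Real.exp (-γ * j) := by
          rw [div_mul_eq_mul_div, le_div_iff₀ hδ]
          linarith
        have h3 := mul_le_mul_of_nonneg_right (le_max_right c (c / δ)) he.le
        have h4 : pH j ≤ 1 := pc_le_one
        have h5 : 0 ≤ p₀ := pc_nonneg
        linarith
  obtain ⟨c, hc, γ, hγ, hle⟩ := key
  refine ⟨c, hc, γ, hγ, fun j hj => ⟨sub_nonneg.2 (hmono j hj), hle j hj⟩, ?_⟩
  have hexp : Filter.Tendsto (fun j : ℕ => p₀ + c * Real.exp (-γ * j)) Filter.atTop (nhds p₀) := by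
    have : Filter.Tendsto (fun j : ℕ => -γ * (j : ℝ)) Filter.atTop Filter.atBot :=
      tendsto_natCast_atTop_atTop.const_mul_atTop_of_neg (neg_lt_zero.2 hγ)
    simpa using ((Real.tendsto_exp_atBot.comp this).const_mul c).const_add p₀
  refine tendsto_of_tendsto_of_tendsto_of_le_of_le' tendsto_const_nhds hexp ?_ ?_
  · filter_upwards [Filter.eventually_ge_atTop 1] with j hj using hmono j hj
  · filter_upwards [Filter.eventually_ge_atTop 1] with j hj
    linarith [hle j hj]
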